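/- arXiv:1908.11793 — 3 statements merged into one kernel-verified Lean document; each statement's English description precedes it below -/
import Mathlib

section
/- Let 𝔽_4 be a field with 4 elements and α ∈ 𝔽_4 with α² + α + 1 = 0. Define F : 𝔽_4³ → 𝔽_4 by F(x_1, x_2, x_3) = x_1x_2 + x_1x_2x_3 + x_2x_3 + x_1x_3. Then as n → ∞, the real sequence (1/4^n) · #{x ∈ 𝔽_4^n : e_5(x) + F(x_1, x_2, x_3) = γ} (defined for n ≥ 3) converges to 129/512 for γ = 0, to 133/512 for γ = 1, and to 125/512 for each γ ∈ {α, α+1}. -/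
open Filter Topology

/-- The elementary symmetric polynomial of degree `k` evaluated at `x ∈ K^n`. -/
def evalE {K : Type*} [CommSemiring K] {n : ℕ} (k : ℕ) (x : Fin n → K) : K :=
  (Multiset.map x Finset.univ.val).esymm k


/-- Equidistribution of a lazy generating random walk on a finite abelian group. -/
lemma walk_tendsto {ι S : Type*} [Fintype ι] [AddCommGroup S] [Fintype S]
    (d : ι → S) (i0 : ι) (h0 : d i0 = 0)
    (hgen : ∀ χ : AddChar S ℂ, (∀ i, χ (d i) = 1) → χ = 0) (f : S → ℂ) (s : S) :
    Tendsto (fun n : ℕ => (∑ y : Fin n → ι, f (s + ∑ i, d (y i))) / (Fintype.card ι : ℂ) ^ n)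
      atTop (𝓝 ((∑ t, f t) / Fintype.card S)) := by
  have hι : (Fintype.card ι : ℂ) ≠ 0 := by
    have : Nonempty ι := ⟨i0⟩
    exact_mod_cast Fintype.card_ne_zero
  have hS : (Fintype.card S : ℂ) ≠ 0 := by
    exact_mod_cast Fintype.card_ne_zero
  have hf : f ∈ Submodule.span ℂ (Set.range (AddChar.complexBasis S)) := by
    rw [Module.Basis.span_eq]; trivial
  induction hf using Submodule.span_induction with
  | zero => simp
  | add f g _ _ hf hg =>
    simpa only [Pi.add_apply, Finset.sum_add_distrib, add_div] using hf.add hg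
  | smul c f _ hf =>
    simpa only [Pi.smul_apply, smul_eq_mul, ← Finset.mul_sum, mul_div_assoc] using hf.const_mul c
  | mem f hf =>
    obtain ⟨χ, rfl⟩ := hf
    rw [AddChar.complexBasis_apply]
    have key : ∀ n : ℕ, (∑ y : Fin n → ι, χ (s + ∑ i, d (y i))) / (Fintype.card ι : ℂ) ^ n
        = χ s * ((∑ i, χ (d i)) / Fintype.card ι) ^ n := by
      intro n
      have : ∀ y : Fin n → ι, χ (s + ∑ i, d (y i)) = χ s * ∏ i, χ (d (y i)) := by
        intro y
        rw [AddChar.map_add_eq_mul]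
        congr 1
        generalize (Finset.univ : Finset (Fin n)) = A
        induction A using Finset.cons_induction with
        | empty => simp
        | cons a A ha ih => rw [Finset.sum_cons, Finset.prod_cons, AddChar.map_add_eq_mul, ih]
      simp_rw [this]
      rw [← Finset.mul_sum, div_pow, mul_div_assoc, Fintype.sum_pow]
    simp_rw [key]
    classical
    rw [AddChar.sum_eq_ite]
    split_ifs with h
    · subst h
      simp [hι, hS]
    · have h1 : ∃ i, χ (d i) ≠ 1 := by
        by_contra! hc
        exact h (hgen χ hc)
      obtain ⟨i, hi⟩ := h1
      have hlt : ‖(∑ i, χ (d i)) / (Fintype.card ι : ℂ)‖ < 1 := by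
        have hp : (0:ℝ) < (Fintype.card ι : ℝ)⁻¹ := by
          have : Nonempty ι := ⟨i0⟩
          have := Fintype.card_pos (α := ι)
          positivity
        have := norm_sum_lt_of_strictConvexSpace (t := Finset.univ) 
          (w := fun _ : ι => (Fintype.card ι : ℝ)⁻¹) (r := 1) (z := fun i => χ (d i))
          (i := i) (j := i0) (fun _ _ => hp.le) (by simpa using mul_inv_cancel₀ (inv_pos.1 hp).ne') (Finset.mem_univ _)
          (Finset.mem_univ _) (by simpa [h0] using hi) hp.ne' hp.ne'
          (by intro i _; simp [AddChar.norm_apply])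
        rw [← Finset.smul_sum] at this
        rw [div_eq_inv_mul]
        simpa using this
      have := (tendsto_pow_atTop_nhds_zero_of_norm_lt_one hlt).const_mul (χ s)
      simpa using this

open Polynomial in
lemma evalE_eq_coeff {K : Type*} [Field K] {n : ℕ} (k : ℕ) (x : Fin n → K) :
    evalE k x = (∏ i, (1 + C (x i) * X : K[X])).coeff k := by
  rw [evalE, Finset.esymm_map_val, Finset.prod_one_add, Polynomial.finsetSum_coeff,
    Finset.powersetCard_eq_filter, Finset.sum_filter]
  refine Finset.sum_congr rfl fun t _ => ?_
  rw [Finset.prod_mul_distrib, Finset.prod_const, ← map_prod, Polynomial.coeff_C_mul_X_pow]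
  simp only [eq_comm]

/-- The finite group of multiplicities modulo 8. -/
abbrev S8 := ZMod 8 × ZMod 8 × ZMod 8

/-- The multiplicity contribution of one coordinate. -/
def stepD {K : Type*} [Field K] [DecidableEq K] (α : K) (x : K) : S8 :=
  if x = 1 then (1, 0, 0) else if x = α then (0, 1, 0) else if x = α + 1 then (0, 0, 1) else 0

open Polynomial in
/-- The generating polynomial attached to a multiplicity vector. -/
noncomputable def genP {K : Type*} [Field K] (α : K) (s : S8) : K[X] :=
  (1 + C 1 * X) ^ s.1.val * (1 + C α * X) ^ s.2.1.val * (1 + C (α + 1) * X) ^ s.2.2.val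

open Polynomial in
lemma pow_step {K : Type*} [Field K] [CharP K 2] (x : K) (a : ZMod 8) :
    (X ^ 8 : K[X]) ∣ (1 + C x * X) ^ a.val * (1 + C x * X) - (1 + C x * X) ^ (a + 1).val := by
  have h8 : (X ^ 8 : K[X]) ∣ (1 + C x * X) ^ 8 - 1 := by
    have : (1 + C x * X : K[X]) ^ 8 = 1 + C (x ^ 8) * X ^ 8 := by
      have := add_pow_char_pow (R := K[X]) (p := 2) (n := 3) 1 (C x * X)
      norm_num at this
      rw [this, mul_pow, C_pow]
    rw [this]
    exact ⟨C (x ^ 8), by ring⟩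
  have : a.val + 1 = 8 * ((a.val + 1) / 8) + (a + 1).val := by
    rw [ZMod.val_add, ZMod.val_one'' (by norm_num)]
    omega
  rw [← pow_succ, this, pow_add, pow_mul, ← sub_one_mul]
  refine Dvd.dvd.mul_right (h8.trans ?_) _
  simpa using sub_dvd_pow_sub_pow ((1 + C x * X : K[X]) ^ 8) 1 ((a.val + 1) / 8)

lemma cover {K : Type*} [Field K] [Fintype K] [DecidableEq K]
    (hK : Fintype.card K = 4) (α : K) (hα : α ^ 2 + α + 1 = 0) (h2 : (2 : K) = 0) (x : K) :
    x = 0 ∨ x = 1 ∨ x = α ∨ x = α + 1 := by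
  have h := FiniteField.pow_card x
  rw [hK] at h
  have h3 : x * ((x - 1) * ((x - α) * (x - (α + 1)))) = 0 := by
    linear_combination h + (x*(x-1)) * hα - (x ^ 3 * α + x^3  - x ^ 2 * α - x^2 + x^2 - x) * h2
  simpa [sub_eq_zero] using h3

open Polynomial in
lemma genP_step {K : Type*} [Field K] [Fintype K] [DecidableEq K] [CharP K 2]
    (hK : Fintype.card K = 4) (α : K) (hα : α ^ 2 + α + 1 = 0) (s : S8) (x : K) :
    (X ^ 8 : K[X]) ∣ genP α s * (1 + C x * X) - genP α (s + stepD α x) := by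
  have h2 : (2 : K) = 0 := CharTwo.two_eq_zero
  have ha0 : α ≠ 0 := by rintro rfl; simp at hα
  have ha1 : α ≠ 1 := by
    rintro rfl
    have : (1 : K) = 0 := by linear_combination hα - h2
    exact one_ne_zero this
  have ha2 : α + 1 ≠ 0 := by
    intro h
    have : (1 : K) = 0 := by linear_combination hα - α * h
    exact one_ne_zero this
  obtain ⟨a, b, c⟩ := s
  rcases cover hK α hα h2 x with rfl | rfl | rfl | rfl
  · have : stepD α 0 = 0 := by
      simp [stepD, ha0.symm, ha2.symm]
    simp [this]
  · have : stepD α 1 = (1, 0, 0) := by simp [stepD]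
    rw [this]
    obtain ⟨q, hq⟩ := pow_step (1 : K) a
    simp only [genP, Prod.mk_add_mk, add_zero]
    refine ⟨q * ((1 + C α * X) ^ b.val * (1 + C (α + 1) * X) ^ c.val), ?_⟩
    linear_combination ((1 + C α * X) ^ b.val * (1 + C (α + 1) * X) ^ c.val) * hq
  · have : stepD x x = (0, 1, 0) := by simp [stepD, ha1]
    rw [this]
    obtain ⟨q, hq⟩ := pow_step x b
    simp only [genP, Prod.mk_add_mk, add_zero]
    refine ⟨q * ((1 + C 1 * X) ^ a.val * (1 + C (x + 1) * X) ^ c.val), ?_⟩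
    linear_combination ((1 + C 1 * X) ^ a.val * (1 + C (x + 1) * X) ^ c.val) * hq
  · have : stepD α (α + 1) = (0, 0, 1) := by simp [stepD, ha0]
    rw [this]
    obtain ⟨q, hq⟩ := pow_step (α + 1) c
    simp only [genP, Prod.mk_add_mk, add_zero]
    refine ⟨q * ((1 + C 1 * X) ^ a.val * (1 + C α * X) ^ b.val), ?_⟩
    linear_combination ((1 + C 1 * X) ^ a.val * (1 + C α * X) ^ b.val) * hq

open Polynomial in
lemma genP_sum {K : Type*} [Field K] [Fintype K] [DecidableEq K] [CharP K 2]
    (hK : Fintype.card K = 4) (α : K) (hα : α ^ 2 + α + 1 = 0) {n : ℕ} (x : Fin n → K) :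
    (X ^ 8 : K[X]) ∣ ∏ i, (1 + C (x i) * X) - genP α (∑ i, stepD α (x i)) := by
  generalize (Finset.univ : Finset (Fin n)) = A
  induction A using Finset.cons_induction with
  | empty => simp [genP]
  | cons a A ha ih =>
    rw [Finset.sum_cons, Finset.prod_cons, add_comm (stepD α (x a))]
    have h1 := genP_step hK α hα (∑ i ∈ A, stepD α (x i)) (x a)
    have h2 := ih.mul_right (1 + C (x a) * X)
    convert h1.add h2 using 1
    ring

lemma evalE_eq {K : Type*} [Field K] [Fintype K] [DecidableEq K] [CharP K 2]
    (hK : Fintype.card K = 4) (α : K) (hα : α ^ 2 + α + 1 = 0) {n : ℕ} (x : Fin n → K) :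
    evalE 5 x = (genP α (∑ i, stepD α (x i))).coeff 5 := by
  rw [evalE_eq_coeff, ← sub_eq_zero, ← Polynomial.coeff_sub]
  exact Polynomial.X_pow_dvd_iff.1 (genP_sum hK α hα x) 5 (by norm_num)

/-- The two-dimensional coordinates on the field with four elements. -/
abbrev Q4 := ZMod 2 × ZMod 2

/-- Multiplication of the field with four elements in coordinates. -/
def qmul (x y : Q4) : Q4 := (x.1 * y.1 + x.2 * y.2, x.1 * y.2 + x.2 * y.1 + x.2 * y.2)

/-- Coordinates of `α ^ m`. -/
def qpow (m : ℕ) : Q4 := if m % 3 = 0 then (1, 0) else if m % 3 = 1 then (0, 1) else (1, 1)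

/-- The coordinate map. -/
def toK {K : Type*} [Field K] [CharP K 2] (α : K) : Q4 →+ K where
  toFun q := ZMod.castHom (dvd_refl 2) K q.1 + ZMod.castHom (dvd_refl 2) K q.2 * α
  map_zero' := by simp
  map_add' x y := by simp only [Prod.fst_add, Prod.snd_add, map_add]; ring

lemma toK_mk {K : Type*} [Field K] [CharP K 2] (α : K) (q : Q4) :
    toK α q = ZMod.castHom (dvd_refl 2) K q.1 + ZMod.castHom (dvd_refl 2) K q.2 * α := rfl

lemma toK_mul {K : Type*} [Field K] [CharP K 2] (α : K) (hα : α ^ 2 + α + 1 = 0) (x y : Q4) :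
    toK α (qmul x y) = toK α x * toK α y := by
  have h2 : (2 : K) = 0 := CharTwo.two_eq_zero
  simp only [toK_mk, qmul, map_add, map_mul]
  generalize ZMod.castHom (dvd_refl 2) K x.1 = a
  generalize ZMod.castHom (dvd_refl 2) K x.2 = b
  generalize ZMod.castHom (dvd_refl 2) K y.1 = c
  generalize ZMod.castHom (dvd_refl 2) K y.2 = d
  linear_combination (-b * d) * hα + (b * d * α + b * d) * h2

lemma toK_pow {K : Type*} [Field K] [CharP K 2] (α : K) (hα : α ^ 2 + α + 1 = 0) (m : ℕ) :
    toK α (qpow m) = α ^ m := by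
  have h2 : (2 : K) = 0 := CharTwo.two_eq_zero
  have h3 : α ^ 3 = 1 := by linear_combination (α - 1) * hα
  rw [← Nat.div_add_mod m 3, pow_add, pow_mul, h3, one_pow, one_mul]
  have : m % 3 < 3 := Nat.mod_lt _ (by norm_num)
  simp only [qpow, Nat.mul_add_mod, Nat.mod_mod]
  interval_cases m % 3
  · simp [toK_mk]
  · simp [toK_mk]
  · simp [toK_mk]; linear_combination -hα + (1 + α) * h2

lemma toK_bij {K : Type*} [Field K] [Fintype K] [CharP K 2]
    (hK : Fintype.card K = 4) (α : K) (hα : α ^ 2 + α + 1 = 0) :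
    Function.Bijective (toK α) := by
  rw [Fintype.bijective_iff_injective_and_card]
  refine ⟨?_, by rw [hK]; rfl⟩
  rw [injective_iff_map_eq_zero]
  have h2 : (2 : K) = 0 := CharTwo.two_eq_zero
  have ha0 : α ≠ 0 := by rintro rfl; simp at hα
  have ha2 : 1 + α ≠ 0 := by
    intro h
    have : (1 : K) = 0 := by linear_combination hα - α * h
    exact one_ne_zero this
  rintro ⟨a, b⟩ h
  rw [toK_mk] at h
  have hz : ∀ z : ZMod 2, z = 0 ∨ z = 1 := by decide
  rcases hz a with rfl | rfl <;> rcases hz b with rfl | rfl <;> simp_all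

/-- Coordinates of `e_5` as a function of the multiplicities. -/
def e5Q (s : S8) : Q4 :=
  ∑ p ∈ Finset.HasAntidiagonal.antidiagonal 5, ∑ q ∈ Finset.HasAntidiagonal.antidiagonal p.1,
    (s.1.val.choose q.1 * s.2.1.val.choose q.2 * s.2.2.val.choose p.2) • qpow (q.2 + 2 * p.2)

open Polynomial in
lemma coeff_lin_pow {K : Type*} [Field K] (x : K) (m k : ℕ) :
    ((1 + C x * X : K[X]) ^ m).coeff k = m.choose k * x ^ k := by
  have : (1 + C x * X : K[X]) ^ m = ((1 + X) ^ m : K[X]).comp (C x * X) := by simp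
  rw [this, comp_C_mul_X_coeff, coeff_one_add_X_pow]

lemma genP_coeff {K : Type*} [Field K] [CharP K 2] (α : K) (hα : α ^ 2 + α + 1 = 0) (s : S8) :
    (genP α s).coeff 5 = toK α (e5Q s) := by
  have h2 : (2 : K) = 0 := CharTwo.two_eq_zero
  have ha : α + 1 = α ^ 2 := by linear_combination -hα + (1 + α) * h2
  rw [genP, Polynomial.coeff_mul, e5Q, map_sum]
  refine Finset.sum_congr rfl fun p _ => ?_
  rw [Polynomial.coeff_mul, map_sum, Finset.sum_mul]
  refine Finset.sum_congr rfl fun q _ => ?_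
  rw [coeff_lin_pow, coeff_lin_pow, coeff_lin_pow, map_nsmul, toK_pow α hα, ha, nsmul_eq_mul]
  push_cast
  ring

/-- The perturbation in coordinates. -/
def pertQ (a b c : Q4) : Q4 := qmul a b + qmul (qmul a b) c + qmul b c + qmul a c

/-- Parity of the binomial coefficient, in cheap arithmetic. -/
def bn (m k : ℕ) : ℕ := 1 - (k - Nat.land m k)

/-- First coordinate of `e_5`. -/
def e5U (a b c : ℕ) : ℕ :=
  (bn a 5 * bn b 0 * bn c 0 + bn a 3 * bn b 2 * bn c 0 + bn a 2 * bn b 3 * bn c 0 +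
    bn a 0 * bn b 5 * bn c 0 + bn a 4 * bn b 0 * bn c 1 + bn a 3 * bn b 1 * bn c 1 +
    bn a 1 * bn b 3 * bn c 1 + bn a 0 * bn b 4 * bn c 1 + bn a 2 * bn b 1 * bn c 2 +
    bn a 1 * bn b 2 * bn c 2 + bn a 2 * bn b 0 * bn c 3 + bn a 0 * bn b 2 * bn c 3 +
    bn a 1 * bn b 0 * bn c 4 + bn a 0 * bn b 1 * bn c 4) % 2

/-- Second coordinate of `e_5`. -/
def e5V (a b c : ℕ) : ℕ :=
  (bn a 4 * bn b 1 * bn c 0 + bn a 3 * bn b 2 * bn c 0 + bn a 1 * bn b 4 * bn c 0 +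
    bn a 0 * bn b 5 * bn c 0 + bn a 4 * bn b 0 * bn c 1 + bn a 2 * bn b 2 * bn c 1 +
    bn a 1 * bn b 3 * bn c 1 + bn a 3 * bn b 0 * bn c 2 + bn a 2 * bn b 1 * bn c 2 +
    bn a 0 * bn b 3 * bn c 2 + bn a 1 * bn b 1 * bn c 3 + bn a 0 * bn b 2 * bn c 3 +
    bn a 1 * bn b 0 * bn c 4 + bn a 0 * bn b 0 * bn c 5) % 2

lemma bn_parity : ∀ (a : Fin 8) (k : Fin 6),
    a.val.choose k.val % 2 = bn a.val k.val % 2 := by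
  decide +kernel

lemma bn_cast : ∀ (a : ZMod 8) (k : Fin 6),
    ((a.val.choose k.val : ℕ) : ZMod 2) = (bn a.val k.val : ZMod 2) := by
  intro a k
  exact (ZMod.natCast_eq_natCast_iff' _ _ 2).2 (bn_parity a k)

lemma e5Q_eq (s : S8) :
    e5Q s = (((e5U s.1.val s.2.1.val s.2.2.val : ℕ) : ZMod 2),
      ((e5V s.1.val s.2.1.val s.2.2.val : ℕ) : ZMod 2)) := by
  obtain ⟨a, b, c⟩ := s
  have h := fun (z : ZMod 8) => And.intro (bn_cast z 0) (And.intro (bn_cast z 1)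
    (And.intro (bn_cast z 2) (And.intro (bn_cast z 3) (And.intro (bn_cast z 4) (bn_cast z 5)))))
  simp only [show ((0 : Fin 6) : ℕ) = 0 from rfl, show ((1 : Fin 6) : ℕ) = 1 from rfl,
    show ((2 : Fin 6) : ℕ) = 2 from rfl, show ((3 : Fin 6) : ℕ) = 3 from rfl,
    show ((4 : Fin 6) : ℕ) = 4 from rfl, show ((5 : Fin 6) : ℕ) = 5 from rfl] at h
  simp only [e5U, e5V, ZMod.natCast_mod]
  push_cast
  obtain ⟨a0, a1, a2, a3, a4, a5⟩ := h a
  obtain ⟨b0, b1, b2, b3, b4, b5⟩ := h b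
  obtain ⟨c0, c1, c2, c3, c4, c5⟩ := h c
  rw [← a0, ← a1, ← a2, ← a3, ← a4, ← a5, ← b0, ← b1, ← b2, ← b3, ← b4, ← b5,
    ← c0, ← c1, ← c2, ← c3, ← c4, ← c5]
  clear a0 a1 a2 a3 a4 a5 b0 b1 b2 b3 b4 b5 c0 c1 c2 c3 c4 c5 h
  simp only [e5Q, Finset.Nat.antidiagonal_succ, Finset.Nat.antidiagonal_zero, Finset.sum_cons,
    Finset.map_singleton, Finset.map_cons, Finset.sum_singleton, Function.Embedding.prodMap,
    Function.Embedding.coeFn_mk, Prod.map, Function.Embedding.refl_apply, Nat.succ_eq_add_one]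
  norm_num [qpow]
  constructor <;> ring

lemma e5N_count : ∀ u v : Fin 2, (Finset.univ.filter (fun s : Fin 8 × Fin 8 × Fin 8 =>
    2 * e5U s.1.val s.2.1.val s.2.2.val + e5V s.1.val s.2.1.val s.2.2.val = 2 * u.val + v.val)).card =
    if 2 * u.val + v.val = 0 then 176 else 112 := by
  decide +kernel

lemma e5Q_count (q : Q4) : (Finset.univ.filter (fun s : S8 => e5Q s = q)).card =
    if q = 0 then 176 else 112 := by
  obtain ⟨u, v⟩ := q
  have h := e5N_count u v
  have hu : u.val < 2 := ZMod.val_lt u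
  have hv : v.val < 2 := ZMod.val_lt v
  have e : (if ((u, v) : Q4) = 0 then 176 else 112) =
      if 2 * u.val + v.val = 0 then 176 else 112 := by
    refine if_congr ?_ rfl rfl
    rw [Prod.mk_eq_zero, ← ZMod.val_eq_zero, ← ZMod.val_eq_zero]
    omega
  rw [e]
  refine Eq.trans ?_ h
  refine congrArg Finset.card (Finset.filter_congr fun s _ => ?_)
  rw [e5Q_eq, Prod.mk.injEq]
  have h1 : e5U s.1.val s.2.1.val s.2.2.val < 2 := Nat.mod_lt _ (by norm_num)
  have h2 : e5V s.1.val s.2.1.val s.2.2.val < 2 := Nat.mod_lt _ (by norm_num)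
  have c1 : ∀ (m : ℕ) (z : ZMod 2), m < 2 → ((m : ZMod 2) = z ↔ m = z.val) := by
    intro m z hm
    constructor
    · rintro rfl
      rw [ZMod.val_natCast, Nat.mod_eq_of_lt hm]
    · rintro rfl
      simp
  rw [c1 _ _ h1, c1 _ _ h2]
  change _ ↔ 2 * e5U s.1.val s.2.1.val s.2.2.val + e5V s.1.val s.2.1.val s.2.2.val =
    2 * u.val + v.val
  omega

lemma pert_count : ∀ q : Q4,
    (∑ w : Q4 × Q4 × Q4, if pertQ w.1 w.2.1 w.2.2 = q then 176 else 112) =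
    if q = 0 then 8256 else if q = (1, 0) then 8512 else 8000 := by
  decide +kernel

lemma walk_tendsto_real {ι S : Type*} [Fintype ι] [AddCommGroup S] [Fintype S]
    (d : ι → S) (i0 : ι) (h0 : d i0 = 0)
    (hgen : ∀ χ : AddChar S ℂ, (∀ i, χ (d i) = 1) → χ = 0) (f : S → ℝ) (s : S) :
    Tendsto (fun n : ℕ => (∑ y : Fin n → ι, f (s + ∑ i, d (y i))) / (Fintype.card ι : ℝ) ^ n)
      atTop (𝓝 ((∑ t, f t) / Fintype.card S)) := by
  have h := walk_tendsto d i0 h0 hgen (fun t => (f t : ℂ)) s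
  have h' := (Complex.continuous_re.tendsto _).comp h
  convert h' using 1
  · funext n
    simp only [Function.comp]
    exact_mod_cast (Complex.ofReal_re _).symm
  · congr 1
    exact_mod_cast (Complex.ofReal_re _).symm

lemma stepD_values {K : Type*} [Field K] [DecidableEq K] [CharP K 2]
    (α : K) (hα : α ^ 2 + α + 1 = 0) :
    stepD α 0 = 0 ∧ stepD α 1 = (1, 0, 0) ∧ stepD α α = (0, 1, 0) ∧
      stepD α (α + 1) = (0, 0, 1) := by
  have h2 : (2 : K) = 0 := CharTwo.two_eq_zero
  have ha0 : α ≠ 0 := by rintro rfl; simp at hα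
  have ha1 : α ≠ 1 := by
    rintro rfl
    have : (1 : K) = 0 := by linear_combination hα - h2
    exact one_ne_zero this
  have ha2 : α + 1 ≠ 0 := by
    intro h
    have : (1 : K) = 0 := by linear_combination hα - α * h
    exact one_ne_zero this
  refine ⟨?_, ?_, ?_, ?_⟩ <;> simp [stepD, ha0, ha1, ha0.symm, ha2.symm]

lemma stepD_gen {K : Type*} [Field K] [DecidableEq K] [CharP K 2]
    (α : K) (hα : α ^ 2 + α + 1 = 0) (χ : AddChar S8 ℂ) (h : ∀ x, χ (stepD α x) = 1) :
    χ = 0 := by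
  obtain ⟨-, h1, h2, h3⟩ := stepD_values α hα
  ext ⟨a, b, c⟩
  have e : ((a, b, c) : S8) = a.val • stepD α 1 + b.val • stepD α α + c.val • stepD α (α + 1) := by
    rw [h1, h2, h3]
    simp
  rw [e]
  simp only [AddChar.map_add_eq_mul, AddChar.map_nsmul_eq_pow, h, one_pow, mul_one, AddChar.zero_apply]

lemma triple_bij {A B : Type*} [Fintype A] [Fintype B] (e : A → B) (he : Function.Bijective e) :
    Function.Bijective (fun w : A × A × A => (![e w.1, e w.2.1, e w.2.2] : Fin 3 → B)) := by
  constructor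
  · rintro ⟨a, b, c⟩ ⟨a', b', c'⟩ h
    have h0 := congrFun h 0
    have h1 := congrFun h 1
    have h2 := congrFun h 2
    simp at h0 h1 h2
    rw [he.1 h0, he.1 h1, he.1 h2]
  · intro f
    obtain ⟨a, ha⟩ := he.2 (f 0)
    obtain ⟨b, hb⟩ := he.2 (f 1)
    obtain ⟨c, hc⟩ := he.2 (f 2)
    refine ⟨(a, b, c), ?_⟩
    ext i
    fin_cases i <;> simp [ha, hb, hc]

lemma main_limit (K : Type*) [Field K] [Fintype K] [DecidableEq K] [CharP K 2]
    (hK : Fintype.card K = 4) (α : K) (hα : α ^ 2 + α + 1 = 0) (q : Q4) :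
    Tendsto (fun n : ℕ =>
        ((Finset.univ.filter (fun x : Fin (3 + n) → K =>
            evalE 5 x +
              (x (Fin.castAdd n 0) * x (Fin.castAdd n 1) +
                x (Fin.castAdd n 0) * x (Fin.castAdd n 1) * x (Fin.castAdd n 2) +
                x (Fin.castAdd n 1) * x (Fin.castAdd n 2) +
                x (Fin.castAdd n 0) * x (Fin.castAdd n 2)) = toK α q)).card : ℝ) /
          (4 : ℝ) ^ (3 + n))
      atTop (𝓝 (((if q = 0 then 8256 else if q = (1, 0) then 8512 else 8000 : ℕ) : ℝ) / 512 / 64)) := by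
  set G : (Fin 3 → K) → K := fun w => w 0 * w 1 + w 0 * w 1 * w 2 + w 1 * w 2 + w 0 * w 2 with hG
  set f : (Fin 3 → K) → S8 → ℝ := fun w t =>
    if (genP α t).coeff 5 + G w = toK α q then 1 else 0 with hf
  have hval := stepD_values α hα
  have hlim : Tendsto (fun n : ℕ => (∑ w : Fin 3 → K,
      (∑ y : Fin n → K, f w (∑ i, stepD α (w i) + ∑ i, stepD α (y i)))
        / (Fintype.card K : ℝ) ^ n) / 64) atTop
      (𝓝 ((∑ w : Fin 3 → K, (∑ t, f w t) / Fintype.card S8) / 64)) :=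
    (tendsto_finsetSum _ fun w _ => walk_tendsto_real (stepD α) 0 hval.1
      (stepD_gen α hα) (f w) _).div_const _
  convert hlim using 1
  · funext n
    rw [← Finset.sum_div, Finset.card_filter, hK, ← Fintype.sum_prod_type',
      ← (Fin.appendEquiv 3 n).sum_comp]
    push_cast
    rw [div_div, pow_add, mul_comm ((4 : ℝ) ^ n), show (4 : ℝ) ^ 3 = 64 by norm_num]
    refine congrArg (fun z : ℝ => z / (64 * 4 ^ n)) ?_
    refine Finset.sum_congr rfl fun p _ => ?_
    rw [evalE_eq hK α hα, Fin.sum_univ_add]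
    simp [hf, hG]
  · congr 2
    rw [← Finset.sum_div]
    have hS : (Fintype.card S8 : ℝ) = 512 := by
      simp [S8, ZMod.card]
    rw [hS]
    congr 1
    rw [← (triple_bij (toK α) (toK_bij hK α hα)).sum_comp, ← pert_count q]
    push_cast
    refine Finset.sum_congr rfl fun w _ => ?_
    have hGw : G ![toK α w.1, toK α w.2.1, toK α w.2.2] = toK α (pertQ w.1 w.2.1 w.2.2) := by
      simp [hG, pertQ, toK_mul α hα]
    have key : ∀ t, f ![toK α w.1, toK α w.2.1, toK α w.2.2] t =
        if e5Q t = q - pertQ w.1 w.2.1 w.2.2 then 1 else 0 := by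
      intro t
      simp only [hf, hGw, genP_coeff α hα, ← map_add, (toK_bij hK α hα).1.eq_iff, eq_sub_iff_add_eq]
    simp_rw [key]
    rw [← Nat.cast_one, ← Nat.cast_zero]
    have := e5Q_count (q - pertQ w.1 w.2.1 w.2.2)
    rw [Finset.card_filter] at this
    have h2 := congrArg (Nat.cast (R := ℝ)) this
    push_cast at h2 ⊢
    rw [h2]
    simp only [sub_eq_zero, eq_comm]

/-- **Example 3.3.** Over `𝔽_4 = 𝔽_2(α)` with `α² + α + 1 = 0`, for the
perturbation `e_{n,5} + F` with `F(x₁,x₂,x₃) = x₁x₂ + x₁x₂x₃ + x₂x₃ + x₁x₃`, the limiting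
value distribution is `129/512` at `0`, `133/512` at `1`, and `125/512` at `α`, `α + 1`. -/
theorem limit_distribution_F4_e5_perturbed (K : Type*) [Field K] [Fintype K] [DecidableEq K]
    (hK : Fintype.card K = 4) (α : K) (hα : α ^ 2 + α + 1 = 0) :
    (Tendsto (fun n : ℕ =>
        ((Finset.univ.filter (fun x : Fin (3 + n) → K =>
            evalE 5 x +
              (x (Fin.castAdd n 0) * x (Fin.castAdd n 1) +
                x (Fin.castAdd n 0) * x (Fin.castAdd n 1) * x (Fin.castAdd n 2) +
                x (Fin.castAdd n 1) * x (Fin.castAdd n 2) +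
                x (Fin.castAdd n 0) * x (Fin.castAdd n 2)) = 0)).card : ℝ) /
          (4 : ℝ) ^ (3 + n))
      atTop (𝓝 (129 / 512))) ∧
    (Tendsto (fun n : ℕ =>
        ((Finset.univ.filter (fun x : Fin (3 + n) → K =>
            evalE 5 x +
              (x (Fin.castAdd n 0) * x (Fin.castAdd n 1) +
                x (Fin.castAdd n 0) * x (Fin.castAdd n 1) * x (Fin.castAdd n 2) +
                x (Fin.castAdd n 1) * x (Fin.castAdd n 2) +
                x (Fin.castAdd n 0) * x (Fin.castAdd n 2)) = 1)).card : ℝ) /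
          (4 : ℝ) ^ (3 + n))
      atTop (𝓝 (133 / 512))) ∧
    (∀ γ : K, (γ = α ∨ γ = α + 1) →
      Tendsto (fun n : ℕ =>
        ((Finset.univ.filter (fun x : Fin (3 + n) → K =>
            evalE 5 x +
              (x (Fin.castAdd n 0) * x (Fin.castAdd n 1) +
                x (Fin.castAdd n 0) * x (Fin.castAdd n 1) * x (Fin.castAdd n 2) +
                x (Fin.castAdd n 1) * x (Fin.castAdd n 2) +
                x (Fin.castAdd n 0) * x (Fin.castAdd n 2)) = γ)).card : ℝ) /
          (4 : ℝ) ^ (3 + n))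
      atTop (𝓝 (125 / 512))) := by
  have h2 : (2 : K) = 0 := by
    have h4 : ((4 : ℕ) : K) = 0 := by rw [← hK]; exact Nat.cast_card_eq_zero K
    have h : (2 : K) * 2 = 0 := by
      push_cast at h4
      linear_combination h4
    exact mul_self_eq_zero.1 h
  have : CharP K 2 := CharTwo.of_one_ne_zero_of_two_eq_zero one_ne_zero h2
  have t0 : toK α (0, 0) = 0 := by simp [toK_mk]
  have t1 : toK α (1, 0) = 1 := by simp [toK_mk]
  have t2 : toK α (0, 1) = α := by simp [toK_mk]
  have t3 : toK α (1, 1) = α + 1 := by simp [toK_mk, add_comm]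
  have m0 := main_limit K hK α hα (0, 0)
  have m1 := main_limit K hK α hα (1, 0)
  have m2 := main_limit K hK α hα (0, 1)
  have m3 := main_limit K hK α hα (1, 1)
  rw [t0] at m0
  rw [t1] at m1
  rw [t2] at m2
  rw [t3] at m3
  rw [if_pos (by decide)] at m0
  rw [if_neg (by decide), if_pos (by decide)] at m1
  rw [if_neg (by decide), if_neg (by decide)] at m2 m3
  norm_num only [Nat.cast_ofNat] at m0 m1 m2 m3 ⊢
  refine ⟨m0, m1, ?_⟩
  rintro γ (rfl | rfl)
  · exact m2
  · exact m3
end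

section
/- Let 𝔽_9 be a field with 9 elements containing 𝔽_3 and let α ∈ 𝔽_9 satisfy α² + 1 = 0. Then as n → ∞, the real sequence (1/9^n) · #{x ∈ 𝔽_9^n : e_4(x) = β} converges to 29/243 for each β in the prime subfield 𝔽_3 ⊆ 𝔽_9, and converges to 26/243 for each β ∈ 𝔽_9 \ 𝔽_3. -/
open Filter Topology

lemma aux_norm_lt {K : Type*} [Fintype K] (f : K → ℂ) (hf : ∀ x, ‖f x‖ = 1) (x0 x1 : K)
    (h0 : f x0 = 1) (h1 : f x1 ≠ 1) : ‖(∑ x, f x) / (Fintype.card K : ℂ)‖ < 1 := by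
  classical
  have hne : x1 ≠ x0 := by rintro rfl; exact h1 h0
  have hs : ∑ x, f x = (f x0 + f x1) + ∑ x ∈ (Finset.univ.erase x0).erase x1, f x := by
    rw [add_assoc, Finset.add_sum_erase _ _ (by simp [hne]), Finset.add_sum_erase _ _ (by simp)]
  have h2 : ‖f x0 + f x1‖ < 2 := by
    have := norm_add_lt_of_not_sameRay (x := f x0) (y := f x1)
      ((not_sameRay_iff_of_norm_eq (by rw [hf, hf])).2 (by rw [h0]; exact Ne.symm h1))
    rw [hf, hf] at this; linarith
  have h3 : ‖∑ x ∈ (Finset.univ.erase x0).erase x1, f x‖ ≤ (Fintype.card K : ℝ) - 2 := by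
    refine (norm_sum_le _ _).trans ?_
    simp only [hf, Finset.sum_const, nsmul_eq_mul, mul_one]
    have e1 := Finset.card_erase_add_one (s := Finset.univ.erase x0) (a := x1) (by simp [hne])
    have e2 := Finset.card_erase_add_one (s := (Finset.univ : Finset K)) (a := x0) (by simp)
    rw [Finset.card_univ] at e2
    rw [← e2, ← e1]; push_cast; linarith
  have hpos : (0 : ℝ) < Fintype.card K := by
    have : Nonempty K := ⟨x0⟩
    exact_mod_cast Fintype.card_pos
  rw [norm_div, Complex.norm_natCast, div_lt_one hpos, hs]
  exact (norm_add_le _ _).trans_lt (by linarith)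

lemma addChar_sum {G : Type*} [AddCommGroup G] (ψ : AddChar G ℂ) {n : ℕ} (f : Fin n → G) :
    ψ (∑ i, f i) = ∏ i, ψ (f i) := by
  induction n with
  | zero => simp
  | succ n ih => rw [Fin.sum_univ_succ, Fin.prod_univ_succ, AddChar.map_add_eq_mul, ih]

lemma equidist {G K : Type*} [AddCommGroup G] [Fintype G] [DecidableEq G] [Fintype K]
    (s : K → G) (x0 : K) (h0 : s x0 = 0)
    (hgen : ∀ ψ : AddChar G ℂ, (∀ x, ψ (s x) = 1) → ψ = 0) (g : G) :
    Tendsto (fun n : ℕ => ((Finset.univ.filter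
      (fun x : Fin n → K => ∑ i, s (x i) = g)).card : ℝ) / (Fintype.card K : ℝ) ^ n)
      atTop (𝓝 (1 / Fintype.card G)) := by
  classical
  have hG : (Fintype.card G : ℂ) ≠ 0 := by exact_mod_cast Fintype.card_ne_zero
  have key : ∀ n : ℕ, (((Finset.univ.filter
      (fun x : Fin n → K => ∑ i, s (x i) = g)).card : ℝ) / (Fintype.card K : ℝ) ^ n : ℝ)
      = (1 / Fintype.card G * ∑ ψ : AddChar G ℂ,
        ψ (-g) * ((∑ x, ψ (s x)) / (Fintype.card K : ℂ)) ^ n).re := by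
    intro n
    rw [← Complex.ofReal_re (_ / _)]
    congr 1
    push_cast
    have : ((Finset.univ.filter (fun x : Fin n → K => ∑ i, s (x i) = g)).card : ℂ)
      = 1 / Fintype.card G * ∑ ψ : AddChar G ℂ, ψ (-g) * (∑ x, ψ (s x)) ^ n := by
      simp_rw [Fintype.sum_pow, Finset.mul_sum]
      rw [Finset.sum_comm]
      have e : ∀ x : Fin n → K, ∑ ψ : AddChar G ℂ, 1 / (Fintype.card G : ℂ) *
          (ψ (-g) * ∏ i, ψ (s (x i))) = if ∑ i, s (x i) = g then 1 else 0 := by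
        intro x
        have := AddChar.sum_apply_eq_ite (-g + ∑ i, s (x i))
        rw [← Finset.mul_sum]
        simp_rw [AddChar.map_add_eq_mul, addChar_sum] at this
        rw [this]
        by_cases h : ∑ i, s (x i) = g
        · simp [h, hG]
        · have : ¬ (-g + ∑ i, s (x i) = 0) := fun h' => h (neg_add_eq_zero.1 h').symm
          simp [h, this]
      rw [Finset.sum_congr rfl (fun x _ => e x)]
      simp
    rw [this]
    simp_rw [div_pow, mul_div_assoc', ← Finset.sum_div]
    rw [mul_div_assoc']
  simp_rw [key]
  have hl : Tendsto (fun n : ℕ => (1 / Fintype.card G * ∑ ψ : AddChar G ℂ,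
        ψ (-g) * ((∑ x, ψ (s x)) / (Fintype.card K : ℂ)) ^ n)) atTop
        (𝓝 (1 / Fintype.card G * ∑ ψ : AddChar G ℂ, if ψ = 0 then 1 else 0)) := by
    refine Tendsto.const_mul _ (tendsto_finsetSum _ fun ψ _ => ?_)
    have hK : (Fintype.card K : ℂ) ≠ 0 := by
      have : Nonempty K := ⟨x0⟩
      exact_mod_cast Fintype.card_ne_zero
    split_ifs with h
    · subst h
      simp [hK]
    · have : ∃ x1, ψ (s x1) ≠ 1 := by
        by_contra! hh
        exact h (hgen ψ hh)
      obtain ⟨x1, h1⟩ := this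
      have := tendsto_pow_atTop_nhds_zero_of_norm_lt_one (aux_norm_lt (fun x => ψ (s x))
        (fun x => AddChar.norm_apply _ _) x0 x1 (by simp [h0]) h1)
      simpa using this.const_mul (ψ (-g))
  have := (Complex.continuous_re.tendsto _).comp hl
  have e : (1 / (Fintype.card G : ℂ) * ∑ ψ : AddChar G ℂ, if ψ = 0 then 1 else 0).re
      = 1 / (Fintype.card G : ℝ) := by
    rw [Finset.sum_ite_eq' , if_pos (Finset.mem_univ _), mul_one, ← Complex.ofReal_natCast,
      ← Complex.ofReal_one, ← Complex.ofReal_div, Complex.ofReal_re]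
  rw [e] at this
  exact this

/-- Truncated polynomials `1 + a t + b t² + c t³` modulo `t⁴`, under multiplication,
written additively. -/
@[ext] structure P3 (K : Type*) where
  a : K
  b : K
  c : K

namespace P3

variable {K : Type*} [Field K]

instance : Add (P3 K) := ⟨fun x y => ⟨x.a + y.a, x.b + y.b + x.a * y.a,
  x.c + y.c + x.a * y.b + x.b * y.a⟩⟩
instance : Zero (P3 K) := ⟨⟨0, 0, 0⟩⟩
instance : Neg (P3 K) := ⟨fun x => ⟨-x.a, x.a ^ 2 - x.b, -x.a ^ 3 + 2 * x.a * x.b - x.c⟩⟩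

@[simp] lemma add_a (x y : P3 K) : (x + y).a = x.a + y.a := rfl
@[simp] lemma add_b (x y : P3 K) : (x + y).b = x.b + y.b + x.a * y.a := rfl
@[simp] lemma add_c (x y : P3 K) : (x + y).c = x.c + y.c + x.a * y.b + x.b * y.a := rfl
@[simp] lemma zero_a : (0 : P3 K).a = 0 := rfl
@[simp] lemma zero_b : (0 : P3 K).b = 0 := rfl
@[simp] lemma zero_c : (0 : P3 K).c = 0 := rfl
@[simp] lemma neg_a (x : P3 K) : (-x).a = -x.a := rfl
@[simp] lemma neg_b (x : P3 K) : (-x).b = x.a ^ 2 - x.b := rfl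
@[simp] lemma neg_c (x : P3 K) : (-x).c = -x.a ^ 3 + 2 * x.a * x.b - x.c := rfl

instance : AddCommGroup (P3 K) where
  add_assoc x y z := by ext <;> simp <;> ring
  zero_add x := by ext <;> simp
  add_zero x := by ext <;> simp
  add_comm x y := by ext <;> simp <;> ring
  neg_add_cancel x := by ext <;> simp <;> ring
  nsmul := nsmulRec
  zsmul := zsmulRec

/-- Coordinates. -/
def equiv (K : Type*) : K × K × K ≃ P3 K where
  toFun p := ⟨p.1, p.2.1, p.2.2⟩
  invFun x := (x.a, x.b, x.c)
  left_inv _ := rfl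
  right_inv _ := rfl

instance [Fintype K] : Fintype (P3 K) := Fintype.ofEquiv _ (equiv K)

end P3

lemma esymm_cons_succ {R : Type*} [CommSemiring R] (x : R) (m : Multiset R) (k : ℕ) :
    (x ::ₘ m).esymm (k + 1) = m.esymm (k + 1) + x * m.esymm k := by
  simp [Multiset.esymm, Multiset.powersetCard_cons, Multiset.sum_map_mul_left]

lemma esymm_zero' {R : Type*} [CommSemiring R] (m : Multiset R) : m.esymm 0 = 1 := by
  simp [Multiset.esymm]

section
variable {K : Type*} [Field K]

/-- The step attached to `x`. -/
def stp (τ : K → ZMod 3) (x : K) : P3 K × ZMod 3 := (⟨x, 0, 0⟩, τ x)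

/-- `e_4` in terms of `e_1, e_2, e_3` and `p_4`. -/
def F4 (h : ZMod 3 →+* K) (g : P3 K × ZMod 3) : K :=
  g.1.a ^ 4 - g.1.b * (g.1.a ^ 2 + g.1.b) + g.1.c * g.1.a - h g.2

lemma three_eq (h : ZMod 3 →+* K) : (3 : K) = 0 := by
  have : h 3 = 0 := by rw [show (3 : ZMod 3) = 0 from rfl, map_zero]
  rwa [map_ofNat] at this

lemma esymm_walk (h : ZMod 3 →+* K) (τ : K → ZMod 3) (hτ : ∀ x, h (τ x) = x ^ 4)
    (m : Multiset K) : m.esymm 1 = (m.map (stp τ)).sum.1.a ∧ m.esymm 2 = (m.map (stp τ)).sum.1.b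
      ∧ m.esymm 3 = (m.map (stp τ)).sum.1.c ∧ m.esymm 4 = F4 h (m.map (stp τ)).sum := by
  have h3 := three_eq h
  induction m using Multiset.induction with
  | empty => simp [Multiset.esymm, F4, Multiset.powersetCard_zero_right]
  | cons x m ih =>
    obtain ⟨h1, h2, h3', h4⟩ := ih
    have e1 := esymm_cons_succ x m 0
    have e2 := esymm_cons_succ x m 1
    have e3 := esymm_cons_succ x m 2
    have e4 := esymm_cons_succ x m 3
    simp only [zero_add, Nat.reduceAdd, esymm_zero'] at e1 e2 e3 e4
    rw [e1, e2, e3, e4, h1, h2, h3', h4]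
    simp only [Multiset.map_cons, Multiset.sum_cons, F4, stp, Prod.fst_add, Prod.snd_add,
      P3.add_a, P3.add_b, P3.add_c, map_add, hτ]
    generalize (Multiset.map (fun x : K => ((⟨x, 0, 0⟩, τ x) : P3 K × ZMod 3)) m).sum = g
    obtain ⟨⟨a, b, c⟩, q⟩ := g
    refine ⟨by ring, by ring, by ring, ?_⟩
    grind

lemma gen (h : ZMod 3 →+* K) (τ : K → ZMod 3) (hτ : ∀ x, h (τ x) = x ^ 4)
    (hcube : ∀ y : K, ∃ z, z ^ 3 = y) (α : K) (hα : α ^ 2 + 1 = 0)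
    (ψ : AddChar (P3 K × ZMod 3) ℂ) (hψ : ∀ x, ψ (stp τ x) = 1) : ψ = 0 := by
  have h3 := three_eq h
  have hinj : Function.Injective h := h.injective
  have t1 : τ 1 = 1 := hinj (by rw [hτ]; simp)
  have tm1 : τ (-1) = 1 := hinj (by rw [hτ, map_one]; ring)
  have ta : τ α = 1 := hinj (by rw [hτ]; simp; grind)
  have tma : τ (-α) = 1 := hinj (by rw [hτ]; simp; grind)
  have hu : ψ (0, 1) = 1 := by
    have : ((0, 1) : P3 K × ZMod 3) = stp τ 1 + stp τ (-1) + stp τ α + stp τ (-α) := by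
      simp only [stp, t1, tm1, ta, tma]
      refine Prod.ext (P3.ext ?_ ?_ ?_) ?_
      · simp
      · simp; grind
      · simp
      · simp; decide
    rw [this]; simp [AddChar.map_add_eq_mul, hψ]
  have hq : ∀ q : ZMod 3, ψ (0, q) = 1 := by
    intro q
    have : ((0, q) : P3 K × ZMod 3) = q.val • (0, 1) := by
      ext <;> simp
    rw [this, AddChar.map_nsmul_eq_pow, hu, one_pow]
  have hc : ∀ c : K, ψ (⟨0, 0, c⟩, 0) = 1 := by
    intro c
    obtain ⟨z, rfl⟩ := hcube c
    have : ((⟨0, 0, z ^ 3⟩, 0) : P3 K × ZMod 3) = stp τ z + stp τ z + stp τ z := by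
      refine Prod.ext (P3.ext ?_ ?_ ?_) ?_
      · simp [stp]; grind
      · simp [stp]; grind
      · simp [stp]; grind
      · simp only [stp, Prod.snd_add]; generalize τ z = t; revert t; decide
    rw [this]; simp [AddChar.map_add_eq_mul, hψ]
  rw [AddChar.eq_zero_iff]
  rintro ⟨⟨a, b, c⟩, q⟩
  have : ((⟨a, b, c⟩, q) : P3 K × ZMod 3) = stp τ a + (stp τ b + stp τ 1 + -stp τ (b + 1)) +
      (⟨0, 0, c - a * b + b * (b + 1)⟩, 0) + (0, q - τ a - τ b - τ 1 + τ (b + 1)) := by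
    refine Prod.ext (P3.ext ?_ ?_ ?_) ?_
    · simp [stp]
    · simp [stp]; ring
    · simp [stp]; ring
    · simp [stp]; ring
  rw [this]; simp [AddChar.map_add_eq_mul, AddChar.map_neg_eq_inv, hψ, hq, hc]

lemma phi_bij [Fintype K] (hK : Fintype.card K = 9) (h : ZMod 3 →+* K) (α : K)
    (hα : α ^ 2 + 1 = 0) :
    Function.Bijective (fun p : ZMod 3 × ZMod 3 => h p.1 + h p.2 * α) := by
  rw [Fintype.bijective_iff_injective_and_card]
  constructor
  · rintro ⟨i, j⟩ ⟨i', j'⟩ e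
    simp only at e
    have : h ((i - i') ^ 2 + (j - j') ^ 2) = 0 := by
      simp only [map_add, map_sub, map_pow]
      grind
    have := (map_eq_zero h).1 this
    rename_i e2
    clear e e2
    revert i j i' j'
    decide
  · simp [hK]

lemma small_count : ∀ u v : ZMod 3, (∑ p : ZMod 3 × ZMod 3, ∑ q : ZMod 3,
    if (-(p.1 ^ 2 - p.2 ^ 2) - q = u ∧ -(2 * p.1 * p.2) = v) then 1 else 0)
      = if v = 0 then 5 else 2 := by decide

lemma M_count [Fintype K] [DecidableEq K] (hK : Fintype.card K = 9) (h : ZMod 3 →+* K) (α : K)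
    (hα : α ^ 2 + 1 = 0) (u v : ZMod 3) :
    (∑ b : K, ∑ q : ZMod 3, if -b ^ 2 - h q = h u + h v * α then 1 else 0)
      = if v = 0 then 5 else 2 := by
  have hb := phi_bij hK h α hα
  rw [← small_count u v, ← (Equiv.ofBijective _ hb).sum_comp]
  refine Finset.sum_congr rfl fun p _ => Finset.sum_congr rfl fun q _ => ?_
  refine if_congr ?_ rfl rfl
  have e : -((Equiv.ofBijective _ hb) p) ^ 2 - h q =
      (fun p : ZMod 3 × ZMod 3 => h p.1 + h p.2 * α)
        (-(p.1 ^ 2 - p.2 ^ 2) - q, -(2 * p.1 * p.2)) := by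
    simp only [Equiv.ofBijective_apply, map_sub, map_neg, map_mul, map_pow, map_ofNat]
    grind
  rw [e]
  constructor
  · intro e'
    have := @hb.1 _ (u, v) e'
    simpa using this
  · rintro ⟨rfl, rfl⟩; rfl

lemma N_count [Fintype K] [DecidableEq K] (hK : Fintype.card K = 9) (h : ZMod 3 →+* K) (β : K) :
    (Finset.univ.filter (fun g : P3 K × ZMod 3 => F4 h g = β)).card =
      216 + 9 * (∑ b : K, ∑ q : ZMod 3, if -b ^ 2 - h q = β then 1 else 0) := by
  rw [Finset.card_filter, Fintype.sum_prod_type, ← (P3.equiv K).sum_comp, Fintype.sum_prod_type]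
  simp_rw [Fintype.sum_prod_type]
  have e : ∀ a : K, (∑ b : K, ∑ c : K, ∑ q : ZMod 3,
      if F4 h (P3.equiv K (a, b, c), q) = β then 1 else 0) =
      if a = 0 then 9 * (∑ b : K, ∑ q : ZMod 3, if -b ^ 2 - h q = β then 1 else 0) else 27 := by
    intro a
    split_ifs with ha
    · subst ha
      rw [Finset.mul_sum]
      refine Finset.sum_congr rfl fun b _ => ?_
      simp [F4, P3.equiv, hK, pow_two]
    · have : ∀ b : K, (∑ c : K, ∑ q : ZMod 3,
        if F4 h (P3.equiv K (a, b, c), q) = β then 1 else 0) = 3 := by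
        intro b
        rw [Finset.sum_comm]
        have : ∀ q : ZMod 3, (∑ c : K,
          if F4 h (P3.equiv K (a, b, c), q) = β then 1 else 0) = 1 := by
          intro q
          have : ∀ c : K, F4 h (P3.equiv K (a, b, c), q) = β ↔
            c = (β - a ^ 4 + b * (a ^ 2 + b) + h q) / a := by
            intro c
            rw [eq_div_iff ha]
            simp only [F4, P3.equiv, Equiv.coe_fn_mk]
            grind
          simp_rw [this]
          simp
        simp_rw [this]
        simp
      simp_rw [this]
      simp [hK]
  rw [Finset.sum_congr rfl fun a _ => e a]
  rw [← Finset.add_sum_erase _ _ (Finset.mem_univ (0 : K)), if_pos rfl,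
    Finset.sum_congr rfl (g := fun _ => 27) (fun a ha => if_neg (Finset.ne_of_mem_erase ha))]
  simp [hK]
  ring

lemma main_tendsto [Fintype K] [DecidableEq K] (hK : Fintype.card K = 9) (h : ZMod 3 →+* K)
    (α : K) (hα : α ^ 2 + 1 = 0) (β : K) :
    Tendsto (fun n : ℕ =>
          ((Finset.univ.filter (fun x : Fin n → K => evalE 4 x = β)).card : ℝ) / (9 : ℝ) ^ n)
        atTop (𝓝 ((216 + 9 * ((∑ b : K, ∑ q : ZMod 3, if -b ^ 2 - h q = β then 1 else 0 : ℕ) : ℝ))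
          / 2187)) := by
  classical
  have h3 := three_eq h
  have h9 : ∀ x : K, x ^ 9 = x := fun x => by rw [← hK]; exact FiniteField.pow_card x
  have hcube : ∀ y : K, ∃ z, z ^ 3 = y := fun y => ⟨y ^ 3, by rw [← pow_mul]; exact h9 y⟩
  have hτ : ∀ x : K, ∃ t : ZMod 3, h t = x ^ 4 := by
    intro x
    have : x ^ 4 * ((x ^ 4 - 1) * (x ^ 4 + 1)) = 0 := by
      have := h9 x
      linear_combination x ^ 3 * this
    rcases mul_eq_zero.1 this with h1 | h1
    · exact ⟨0, by simp [h1]⟩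
    rcases mul_eq_zero.1 h1 with h1 | h1
    · exact ⟨1, by simp; linear_combination -h1⟩
    · exact ⟨-1, by simp; linear_combination -h1⟩
  choose τ hτ using hτ
  have ht0 : τ 0 = 0 := h.injective (by rw [hτ]; simp)
  have hs0 : stp τ 0 = 0 := by
    refine Prod.ext (P3.ext rfl rfl rfl) ht0
  have hcard : Fintype.card (P3 K × ZMod 3) = 2187 := by
    rw [Fintype.card_prod, ← Fintype.card_congr (P3.equiv K)]
    simp [hK]
  have hE : ∀ (n : ℕ) (x : Fin n → K), evalE 4 x = F4 h (∑ i, stp τ (x i)) := by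
    intro n x
    have := (esymm_walk h τ hτ (Multiset.map x Finset.univ.val)).2.2.2
    rw [Multiset.map_map] at this
    exact this
  have hN : ∀ n : ℕ, ((Finset.univ.filter (fun x : Fin n → K => evalE 4 x = β)).card : ℝ)
      / (9 : ℝ) ^ n = ∑ g ∈ Finset.univ.filter (fun g : P3 K × ZMod 3 => F4 h g = β),
      ((Finset.univ.filter (fun x : Fin n → K => ∑ i, stp τ (x i) = g)).card : ℝ)
        / (Fintype.card K : ℝ) ^ n := by
    intro n
    rw [← Finset.sum_div, hK]
    congr 1
    norm_cast
    rw [Finset.card_eq_sum_card_fiberwise (f := fun x : Fin n → K => ∑ i, stp τ (x i))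
      (t := Finset.univ.filter (fun g : P3 K × ZMod 3 => F4 h g = β))]
    · refine Finset.sum_congr rfl fun g hg => ?_
      congr 1
      ext x
      simp only [Finset.mem_filter, Finset.mem_univ, true_and] at hg ⊢
      rw [hE]
      constructor
      · exact fun h => h.2
      · intro hx; rw [hx]; exact ⟨hg, rfl⟩
    · intro x hx
      simpa [hE] using hx
  simp_rw [hN]
  have := tendsto_finsetSum (Finset.univ.filter (fun g : P3 K × ZMod 3 => F4 h g = β))
    (fun g _ => equidist (stp τ) 0 hs0 (gen h τ hτ hcube α hα) g)
  rw [Finset.sum_const, N_count hK, hcard, nsmul_eq_mul] at this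
  convert this using 2
  push_cast
  ring

end

/-- **equation (3.11).** Over `𝔽_9 = 𝔽_3(α)` with `α² + 1 = 0`, the limiting
value distribution of `e_4` is `29/243` at each element of the prime subfield `𝔽_3` (the
image of `ℤ`), and `26/243` at each element of `𝔽_9 \ 𝔽_3`. -/
theorem limit_distribution_F9_e4 (K : Type*) [Field K] [Fintype K] [DecidableEq K]
    (hK : Fintype.card K = 9) (α : K) (hα : α ^ 2 + 1 = 0) :
    (∀ β : K, (∃ m : ℤ, (m : K) = β) →
      Tendsto (fun n : ℕ =>
          ((Finset.univ.filter (fun x : Fin n → K => evalE 4 x = β)).card : ℝ) / (9 : ℝ) ^ n)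
        atTop (𝓝 (29 / 243))) ∧
    (∀ β : K, (¬ ∃ m : ℤ, (m : K) = β) →
      Tendsto (fun n : ℕ =>
          ((Finset.univ.filter (fun x : Fin n → K => evalE 4 x = β)).card : ℝ) / (9 : ℝ) ^ n)
        atTop (𝓝 (26 / 243))) := by
  have hchar : CharP K 3 := by
    obtain ⟨p, hp⟩ := CharP.exists K
    obtain ⟨n, hpp, hn⟩ := FiniteField.card K p
    rw [hK] at hn
    have : p ∣ 3 ^ 2 := by
      rw [show 3 ^ 2 = 9 by norm_num, hn]; exact dvd_pow_self p n.ne_zero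
    have := (Nat.prime_dvd_prime_iff_eq hpp Nat.prime_three).1 (hpp.dvd_of_dvd_pow this)
    exact this ▸ hp
  let h : ZMod 3 →+* K := ZMod.castHom (dvd_refl 3) K
  constructor
  · rintro β ⟨m, rfl⟩
    have := main_tendsto hK h α hα (m : K)
    have hβ : (m : K) = h (m : ZMod 3) + h 0 * α := by simp
    have hc := M_count hK h α hα (m : ZMod 3) 0
    rw [← hβ] at hc
    rw [hc] at this
    convert this using 2
    norm_num
  · intro β hβ
    obtain ⟨⟨u, v⟩, huv⟩ := (phi_bij hK h α hα).2 β
    simp only at huv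
    have hv : v ≠ 0 := by
      rintro rfl
      refine hβ ⟨(u.val : ℤ), ?_⟩
      rw [← huv]
      have : h ((u.val : ℕ) : ZMod 3) = h u := by rw [ZMod.natCast_zmod_val]
      rw [map_natCast] at this
      rw [Int.cast_natCast, this]
      simp
    have := main_tendsto hK h α hα β
    have hc := M_count hK h α hα u v
    rw [huv] at hc
    rw [hc, if_neg hv] at this
    convert this using 2
    norm_num
end

section
/- Let 𝔽_8 be a field with 8 elements and α ∈ 𝔽_8 with α³ + α + 1 = 0. Then as n → ∞: (i) the real sequence (1/8^n) · #{x ∈ 𝔽_8^n : e_5(x) = β} converges to 71/512 for β = 0 and to 63/512 for each β ∈ 𝔽_8 \ {0}; and (ii) the real sequence (1/8^n) · #{x ∈ 𝔽_8^n : e_7(x) = β} converges to 67/512 for each β ∈ {0, 1} and to 63/512 for each β ∈ 𝔽_8 \ {0, 1}. -/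
open Filter Topology

open Polynomial

set_option linter.unusedSectionVars false

noncomputable section

namespace F8

variable {K : Type*} [Field K] [Fintype K] [DecidableEq K]

/-- The linear factor `1 + yX`. -/
def lin (y : K) : K[X] := 1 + C y * X

/-- The product of linear factors attached to a vector. -/
def W {n : ℕ} (x : Fin n → K) : K[X] := ∏ i, lin (x i)

/-- Unnormalised averaging operator. -/
def SS (n : ℕ) (f : K[X] → ℝ) (g : K[X]) : ℝ := ∑ x : Fin n → K, f (g * W x)

/-- Expectation. -/
def E (n : ℕ) (f : K[X] → ℝ) : ℝ := SS n f 1 / 8 ^ n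

lemma coeff_W {n : ℕ} (x : Fin n → K) (k : ℕ) : (W x).coeff k = evalE k x := by
  unfold W lin evalE
  rw [Finset.prod_one_add, Finset.esymm_map_val, finsetSum_coeff, Finset.powersetCard_eq_filter,
    Finset.sum_filter]
  refine Finset.sum_congr rfl fun t _ => ?_
  rw [Finset.prod_mul_distrib, Finset.prod_const, ← map_prod, coeff_C_mul, coeff_X_pow]
  by_cases h : t.card = k
  · simp [h]
  · simp [h, Ne.symm h]

lemma SS_add (m n : ℕ) (f : K[X] → ℝ) (g : K[X]) : SS (m + n) f g = SS m (SS n f) g := by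
  unfold SS
  rw [← (Fin.appendEquiv m n).sum_comp, Fintype.sum_prod_type]
  refine Finset.sum_congr rfl fun a _ => Finset.sum_congr rfl fun b _ => ?_
  simp [W, Fin.appendEquiv, Fin.prod_univ_add, mul_assoc]


lemma SS_bound (hK : Fintype.card K = 8) (n : ℕ) (f : K[X] → ℝ) (c : ℝ) (hf : ∀ p, |f p| ≤ c) (g : K[X]) :
    |SS n f g| ≤ 8 ^ n * c := by
  unfold SS
  refine (Finset.abs_sum_le_sum_abs _ _).trans ((Finset.sum_le_card_nsmul _ _ c fun x _ => hf _).trans ?_)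
  simp [hK]

lemma SS_seven (hK : Fintype.card K = 8) (y : K) (hy : y ≠ 0) (h : K[X] → ℝ) (c : ℝ) (hb : ∀ p, |h p| ≤ c)
    (hz : ∀ p, ∑ j ∈ Finset.range 8, h (p * lin y ^ j) = 0) (g : K[X]) :
    |SS 7 h g| ≤ (8 ^ 7 - 8) * c := by
  set w : ℕ → Fin 7 → K := fun j i => if (i : ℕ) < j then y else 0 with hw
  have hinj : Set.InjOn w (Finset.range 8 : Finset ℕ) := by
    intro a ha b hb hab
    simp only [Finset.coe_range, Set.mem_Iio] at ha hb
    by_contra hne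
    rcases lt_or_gt_of_ne hne with hlt | hlt
    · have := congrFun hab ⟨a, by omega⟩
      simp [hw, hlt] at this
      exact hy this.symm
    · have := congrFun hab ⟨b, by omega⟩
      simp [hw, hlt] at this
      exact hy this
  have hWw : ∀ j ∈ Finset.range 8, W (w j) = lin y ^ j := by
    intro j hj
    have h0 : lin (0 : K) = 1 := by simp [lin]
    fin_cases hj <;> simp [W, hw, Fin.prod_univ_succ, h0, pow_succ, mul_assoc]
  have hs : ∑ x ∈ (Finset.range 8).image w, h (g * W x) = 0 := by
    rw [Finset.sum_image hinj, ← hz g]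
    exact Finset.sum_congr rfl fun j hj => by rw [hWw j hj]
  have hc : ((Finset.range 8).image w).card = 8 := by
    rw [Finset.card_image_of_injOn hinj]; simp
  unfold SS
  rw [← Finset.sum_add_sum_compl ((Finset.range 8).image w), hs, zero_add]
  refine (Finset.abs_sum_le_sum_abs _ _).trans ((Finset.sum_le_card_nsmul _ _ c fun x _ => hb _).trans ?_)
  rw [Finset.card_compl, hc]
  simp [hK]
  norm_num

lemma SS_zero_sum (n : ℕ) (y : K) (h : K[X] → ℝ) 
    (hz : ∀ p, ∑ j ∈ Finset.range 8, h (p * lin y ^ j) = 0) (p : K[X]) :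
    ∑ j ∈ Finset.range 8, SS n h (p * lin y ^ j) = 0 := by
  unfold SS
  rw [Finset.sum_comm]
  refine Finset.sum_eq_zero fun x _ => ?_
  rw [← hz (p * W x)]
  exact Finset.sum_congr rfl fun j _ => by congr 1; ring

lemma SS_bound_iter (hK : Fintype.card K = 8) (y : K) (hy : y ≠ 0) (h : K[X] → ℝ) (c : ℝ) (hb : ∀ p, |h p| ≤ c)
    (hz : ∀ p, ∑ j ∈ Finset.range 8, h (p * lin y ^ j) = 0) (q r : ℕ) (g : K[X]) :
    |SS (7 * q + r) h g| ≤ (8 ^ 7 - 8) ^ q * (8 ^ r * c) := by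
  induction q generalizing g with
  | zero => simpa using SS_bound hK r h c hb g
  | succ q ih =>
    have : 7 * (q + 1) + r = 7 + (7 * q + r) := by ring
    rw [this, SS_add, pow_succ', mul_assoc]
    exact SS_seven hK y hy _ _ ih (SS_zero_sum _ y h hz) g

lemma E_tendsto_zero (hK : Fintype.card K = 8) (y : K) (hy : y ≠ 0) (h : K[X] → ℝ) (c : ℝ) (hb : ∀ p, |h p| ≤ c)
    (hz : ∀ p, ∑ j ∈ Finset.range 8, h (p * lin y ^ j) = 0) :
    Tendsto (fun n => E n h) atTop (𝓝 0) := by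
  have hlim : Tendsto (fun n : ℕ => ((8 ^ 7 - 8) / 8 ^ 7 : ℝ) ^ (n / 7) * c) atTop (𝓝 0) := by
    rw [← zero_mul c]
    refine Tendsto.mul_const c ?_
    exact (tendsto_pow_atTop_nhds_zero_of_lt_one (by norm_num) (by norm_num)).comp
      (Nat.tendsto_div_const_atTop (by norm_num))
  refine squeeze_zero_norm (fun n => ?_) hlim
  unfold E
  rw [Real.norm_eq_abs, abs_div, abs_of_pos (by positivity : (0 : ℝ) < 8 ^ n),
    div_le_iff₀ (by positivity)]
  have h1 := SS_bound_iter hK y hy h c hb hz (n / 7) (n % 7) 1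
  rw [Nat.div_add_mod] at h1
  refine h1.trans (le_of_eq ?_)
  have h2 : (8 : ℝ) ^ n = (8 ^ 7) ^ (n / 7) * 8 ^ (n % 7) := by
    rw [← pow_mul, ← pow_add, Nat.div_add_mod]
  rw [h2, div_pow]
  field_simp

/-- Bounded functions that only depend on the first eight coefficients. -/
def Good (f : K[X] → ℝ) : Prop :=
  (∀ p q : K[X], (∀ i < 8, p.coeff i = q.coeff i) → f p = f q) ∧ ∃ c, ∀ p, |f p| ≤ c

lemma coeff_mul_congr (p q r : K[X]) (h : ∀ i < 8, p.coeff i = q.coeff i) :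
    ∀ i < 8, (p * r).coeff i = (q * r).coeff i := by
  intro i hi
  rw [coeff_mul, coeff_mul]
  refine Finset.sum_congr rfl fun a ha => ?_
  rw [Finset.HasAntidiagonal.mem_antidiagonal] at ha
  rw [h a.1 (by omega)]

lemma Good.shift {f : K[X] → ℝ} (hf : Good f) (r : K[X]) : Good (fun p => f (p * r)) := by
  obtain ⟨h1, c, h2⟩ := hf
  exact ⟨fun p q h => h1 _ _ (coeff_mul_congr p q r h), c, fun p => h2 _⟩

lemma char_two (hK : Fintype.card K = 8) : CharP K 2 := by
  obtain ⟨p, hp⟩ := CharP.exists K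
  have hpp : p.Prime := CharP.char_is_prime K p
  have hd : (8 : K) = 0 := by
    have := FiniteField.cast_card_eq_zero K
    rw [hK] at this; exact_mod_cast this
  have : p ∣ 8 := (CharP.cast_eq_zero_iff K p 8).1 (by exact_mod_cast hd)
  have h2 : p ∣ 2 := hpp.dvd_of_dvd_pow (show p ∣ 2 ^ 3 by simpa using this)
  have := (Nat.prime_dvd_prime_iff_eq hpp Nat.prime_two).1 h2
  exact this ▸ hp

lemma lin_sq (hK : Fintype.card K = 8) (y : K) : lin y ^ 2 = 1 + C (y ^ 2) * X ^ 2 := by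
  have := char_two hK
  unfold lin
  rw [add_pow_char _ _ 2]; simp [mul_pow]

lemma lin_four (hK : Fintype.card K = 8) (y : K) : lin y ^ 4 = 1 + C (y ^ 4) * X ^ 4 := by
  have := char_two hK
  rw [show 4 = 2 * 2 from rfl, pow_mul, lin_sq hK, add_pow_char _ _ 2]; simp [mul_pow, ← pow_mul]

lemma lin_eight (hK : Fintype.card K = 8) (y : K) : lin y ^ 8 = 1 + C (y ^ 8) * X ^ 8 := by
  have := char_two hK
  rw [show 8 = 4 * 2 from rfl, pow_mul, lin_four hK, add_pow_char _ _ 2]; simp [mul_pow, ← pow_mul]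

lemma shift_one (hK : Fintype.card K = 8) (f : K[X] → ℝ) (hf : Good f) (y : K) :
    Tendsto (fun n => E n (fun p => f (p * lin y)) - E n f) atTop (𝓝 0) := by
  by_cases hy : y = 0
  · subst hy; simp [lin]
  obtain ⟨h1, c, h2⟩ := hf
  have := E_tendsto_zero hK y hy (fun p => f (p * lin y) - f p) (c + c)
    (fun p => (abs_sub _ _).trans (add_le_add (h2 _) (h2 _))) (fun p => ?_)
  · refine this.congr fun n => ?_
    simp only [E, SS, Finset.sum_sub_distrib, sub_div]
  · have e : ∀ j ∈ Finset.range 8, f (p * lin y ^ j * lin y) - f (p * lin y ^ j) =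
      (fun j => f (p * lin y ^ j)) (j + 1) - (fun j => f (p * lin y ^ j)) j := by
      intro j _; simp only [pow_succ, mul_assoc]
    rw [Finset.sum_congr rfl e, Finset.sum_range_sub (fun j => f (p * lin y ^ j)), sub_eq_zero]
    apply h1
    intro i hi
    rw [lin_eight hK, mul_add, ← mul_assoc, coeff_add, coeff_mul_X_pow', if_neg (by omega)]
    simp

lemma shift_list (hK : Fintype.card K = 8) (f : K[X] → ℝ) (hf : Good f) (l : List K) :
    Tendsto (fun n => E n (fun p => f (p * (l.map lin).prod)) - E n f) atTop (𝓝 0) := by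
  induction l with
  | nil => simp
  | cons a l ih =>
    have := (shift_one hK _ (hf.shift (l.map lin).prod) a).add ih
    rw [add_zero] at this
    refine this.congr fun n => ?_
    simp [mul_assoc]

lemma avg (hK : Fintype.card K = 8) {ι : Type*} [Fintype ι] [Nonempty ι] (f g : K[X] → ℝ) (hf : Good f) (l : ι → List K)
    (h : ∀ (n : ℕ) (x : Fin n → K), ∑ i, f (W x * ((l i).map lin).prod) = g (W x)) {a : ℝ}
    (hg : Tendsto (fun n => E n g) atTop (𝓝 a)) :
    Tendsto (fun n => E n f) atTop (𝓝 (a / Fintype.card ι)) := by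
  have h1 := tendsto_finsetSum (Finset.univ : Finset ι) (fun i _ => shift_list hK f hf (l i))
  have h2 := (hg.sub h1).div_const (Fintype.card ι : ℝ)
  simp only [Finset.sum_const_zero, sub_zero] at h2
  refine h2.congr fun n => ?_
  have hc : (Fintype.card ι : ℝ) ≠ 0 := by exact_mod_cast Fintype.card_ne_zero
  have h3 : ∑ i, E n (fun p => f (p * ((l i).map lin).prod)) = E n g := by
    unfold E SS
    rw [← Finset.sum_div, Finset.sum_comm]
    congr 1
    exact Finset.sum_congr rfl fun x _ => by rw [one_mul]; exact h n x
  rw [Finset.sum_sub_distrib, h3]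
  simp only [Finset.sum_const, Finset.card_univ, nsmul_eq_mul]
  field_simp
  ring

lemma pow_eight (hK : Fintype.card K = 8) (y : K) : y ^ 8 = y := by
  have := FiniteField.pow_card y
  rwa [hK] at this

lemma two_zero (hK : Fintype.card K = 8) : (2 : K) = 0 := by
  have := char_two hK
  exact_mod_cast CharP.cast_eq_zero K 2

lemma newton_aux {n : ℕ} (x : Fin n → K) (k : ℕ) :
    (k : K) * evalE k x = (-1) ^ (k + 1) *
      ∑ j ∈ Finset.range k, (-1) ^ j * evalE j x * ∑ i, x i ^ (k - j) := by
  have h := congrArg (MvPolynomial.aeval x) (MvPolynomial.mul_esymm_eq_sum (Fin n) K k)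
  simp only [map_mul, map_natCast, map_pow, map_neg, map_one, map_sum,
    MvPolynomial.aeval_esymm_eq_multiset_esymm, MvPolynomial.psum, MvPolynomial.aeval_X] at h
  rw [Finset.sum_filter, Finset.Nat.sum_antidiagonal_eq_sum_range_succ_mk, Finset.sum_range_succ] at h
  simp only [lt_irrefl, if_false, add_zero] at h
  unfold evalE
  rw [h]
  congr 1
  refine Finset.sum_congr rfl fun j hj => ?_
  rw [if_pos (Finset.mem_range.1 hj)]

lemma evalE_zero {n : ℕ} (x : Fin n → K) : evalE 0 x = 1 := by
  unfold evalE
  rw [Finset.esymm_map_val]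
  simp

lemma newton (hK : Fintype.card K = 8) {n : ℕ} (x : Fin n → K) (h1 : evalE 1 x = 0) (h3 : evalE 3 x = 0) :
    evalE 5 x = 0 ∧ (evalE 7 x = 0 ∨ evalE 7 x = 1) := by
  have h2z := two_zero hK
  have hch := char_two hK
  have sq : ∀ k, (∑ i, x i ^ k) ^ 2 = ∑ i, x i ^ (k * 2) := by
    intro k
    rw [sum_pow_char 2]
    simp [pow_mul]
  have n1 := newton_aux x 1
  have n3 := newton_aux x 3
  have n5 := newton_aux x 5
  have n7 := newton_aux x 7
  have s1 := sq 1
  have s2 := sq 2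
  have s3 := sq 3
  have s6 := sq 6
  have s7 := sq 7
  have p12 : ∑ i, x i ^ 12 = ∑ i, x i ^ 5 := Finset.sum_congr rfl fun i _ => by
    linear_combination x i ^ 4 * pow_eight hK (x i)
  have p14 : ∑ i, x i ^ 14 = ∑ i, x i ^ 7 := Finset.sum_congr rfl fun i _ => by
    linear_combination x i ^ 6 * pow_eight hK (x i)
  simp only [Finset.sum_range_succ, Finset.sum_range_zero, evalE_zero, h1, h3] at n1 n3 n5 n7
  norm_num at n1 n3 n5 n7 s1 s2 s3 s6 s7
  rw [p12] at s6
  rw [p14] at s7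
  generalize (∑ i, x i ^ 7) = p7 at *
  generalize (∑ i, x i ^ 6) = p6 at *
  generalize (∑ i, x i ^ 5) = p5 at *
  generalize (∑ i, x i ^ 4) = p4 at *
  generalize (∑ i, x i ^ 3) = p3 at *
  generalize (∑ i, x i ^ 2) = p2 at *
  generalize (∑ i, x i) = p1 at *
  subst n1
  have e2 : p2 = 0 := by simpa using s1.symm
  subst e2
  have e4 : p4 = 0 := by simpa using s2.symm
  subst e4
  have e3 : p3 = 0 := by simpa using n3.symm
  subst e3
  have e6 : p6 = 0 := by simpa using s3.symm
  subst e6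
  have e5 : p5 = 0 := by simpa using s6.symm
  subst e5
  refine ⟨?_, ?_⟩
  · linear_combination n5 - 2 * evalE 5 x * h2z
  · have e7 : evalE 7 x = p7 := by linear_combination n7 - 3 * evalE 7 x * h2z
    rw [e7]
    have : p7 * (p7 - 1) = 0 := by linear_combination s7
    rcases mul_eq_zero.1 this with h | h
    · exact Or.inl h
    · exact Or.inr (sub_eq_zero.1 h)

lemma sum_ind (hK : Fintype.card K = 8) (m : ℕ) (hm : m = 1 ∨ m = 2 ∨ m = 3 ∨ m = 4 ∨ m = 6) (c a β : K) (ha : a ≠ 0) :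
    ∑ y : K, (if c + a * y ^ m = β then (1 : ℝ) else 0) = 1 := by
  have hinj : Function.Injective (fun y : K => c + a * y ^ m) := by
    intro y z h
    have h' : y ^ m = z ^ m := mul_left_cancel₀ ha (add_left_cancel h)
    have key : ∃ r, ∀ y : K, (y ^ m) ^ r = y := by
      have h8 := pow_eight hK
      rcases hm with rfl | rfl | rfl | rfl | rfl
      · exact ⟨1, fun y => by ring⟩
      · exact ⟨4, fun y => by linear_combination h8 y⟩
      · exact ⟨5, fun y => by linear_combination (y ^ 7 + 1) * h8 y⟩
      · exact ⟨2, fun y => by linear_combination h8 y⟩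
      · exact ⟨6, fun y => by
          linear_combination (y ^ 28 + y ^ 21 + y ^ 14 + y ^ 7 + 1) * h8 y⟩
    obtain ⟨r, hr⟩ := key
    rw [← hr y, ← hr z, h']
  obtain ⟨y, hy, hu⟩ := (Finite.injective_iff_bijective.1 hinj).existsUnique β
  rw [Finset.sum_eq_single y]
  · exact if_pos hy
  · intro z _ hz
    exact if_neg fun h => hz (hu z h)
  · simp

/-- Indicator of a condition on the coefficients of index `0, 1, 3, k`. -/
def ind (k : ℕ) (R : K → K → K → K → Prop) (p : K[X]) : ℝ :=
  open Classical in if R (p.coeff 0) (p.coeff 1) (p.coeff 3) (p.coeff k) then 1 else 0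

lemma ind_good (k : ℕ) (hk : k < 8) (R : K → K → K → K → Prop) : Good (ind k R) := by
  refine ⟨fun p q h => ?_, 1, fun p => ?_⟩
  · unfold ind
    rw [h 0 (by omega), h 1 (by omega), h 3 (by omega), h k hk]
  · unfold ind
    split_ifs <;> simp

lemma coeff_mul_one_add (p : K[X]) (a : K) (m i : ℕ) :
    (p * (1 + C a * X ^ m)).coeff i = p.coeff i + a * (if m ≤ i then p.coeff (i - m) else 0) := by
  rw [mul_add, mul_one, coeff_add, mul_left_comm, coeff_C_mul, coeff_mul_X_pow']

lemma lin_triple (hK : Fintype.card K = 8) (a b : K) : lin a * lin b * lin (a + b) =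
    1 + C (a ^ 2 + a * b + b ^ 2) * X ^ 2 + C (a * b * (a + b)) * X ^ 3 := by
  have h2 : (2 : K[X]) = 0 := by
    rw [← map_ofNat (C : K →+* K[X]) 2, two_zero hK, map_zero]
  unfold lin
  simp only [map_add, map_mul, map_pow]
  linear_combination ((C a + C b) * X + C a * C b * X ^ 2) * h2

lemma lin_triple_sq (hK : Fintype.card K = 8) (a b : K) : (lin a * lin b * lin (a + b)) ^ 2 *
    lin ((a ^ 2 + a * b + b ^ 2) ^ 4) ^ 4 =
    1 + C ((a * b * (a + b)) ^ 2) * X ^ 6 + X ^ 8 * (C ((a ^ 2 + a * b + b ^ 2) ^ 4) +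
      C ((a ^ 2 + a * b + b ^ 2) ^ 2 * (a * b * (a + b)) ^ 2) * X ^ 2) := by
  have h2 : (2 : K[X]) = 0 := by
    rw [← map_ofNat (C : K →+* K[X]) 2, two_zero hK, map_zero]
  rw [lin_triple hK, lin_four hK]
  generalize a ^ 2 + a * b + b ^ 2 = q
  generalize a * b * (a + b) = k
  have : (q ^ 4) ^ 4 = q ^ 2 := by linear_combination (q ^ 8 + q) * pow_eight hK q
  rw [this]
  simp only [map_mul, map_pow]
  linear_combination (C q * X ^ 2 + C k * X ^ 3 + C q * C k * X ^ 5 + C q ^ 2 * X ^ 4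
    + C q ^ 3 * X ^ 6 + C q ^ 2 * C k * X ^ 7 + C q ^ 3 * C k * X ^ 9) * h2

lemma lin_all (hK : Fintype.card K = 8) (α : K) (hα : α ^ 3 + α + 1 = 0) :
    ([1, α, α ^ 2, α ^ 4, α ^ 3, α ^ 6, α ^ 5].map lin).prod = 1 + C 1 * X ^ 7 := by
  have h2 : (2 : K[X]) = 0 := by
    rw [← map_ofNat (C : K →+* K[X]) 2, two_zero hK, map_zero]
  have h2z := two_zero hK
  have h3 : ∀ a b c : K, lin a * lin b * lin c = 1 + C (a + b + c) * X
      + C (a * b + b * c + a * c) * X ^ 2 + C (a * b * c) * X ^ 3 := by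
    intro a b c
    unfold lin
    simp only [map_add, map_mul]
    ring
  have a3 : α ^ 3 = α + 1 := by linear_combination hα - (α + 1) * h2z
  have a4 : α ^ 4 = α ^ 2 + α := by linear_combination α * a3
  have a5 : α ^ 5 = α ^ 2 + α + 1 := by linear_combination α * a4 + a3
  have a6 : α ^ 6 = α ^ 2 + 1 := by linear_combination α * a5 + a3 + α * h2z
  have a7 : α ^ 7 = 1 := by linear_combination α * a6 + a3 + α * h2z
  have A : lin α * lin (α ^ 2) * lin (α ^ 4) = 1 + X ^ 2 + X ^ 3 := by
    rw [h3, show α + α ^ 2 + α ^ 4 = 0 by linear_combination a4 + (α + α ^ 2) * h2z,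
      show α * α ^ 2 + α ^ 2 * α ^ 4 + α * α ^ 4 = 1 by
        linear_combination a3 + a5 + a6 + (α ^ 2 + α + 1) * h2z,
      show α * α ^ 2 * α ^ 4 = 1 by linear_combination a7]
    simp
  have B : lin (α ^ 3) * lin (α ^ 6) * lin (α ^ 5) = 1 + X + X ^ 3 := by
    rw [h3, show α ^ 3 + α ^ 6 + α ^ 5 = 1 by
        linear_combination a3 + a5 + a6 + (α ^ 2 + α + 1) * h2z,
      show α ^ 3 * α ^ 6 + α ^ 6 * α ^ 5 + α ^ 3 * α ^ 5 = 0 by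
        linear_combination (α ^ 2 + α ^ 4 + α) * a7 + a4 + (α + α ^ 2) * h2z,
      show α ^ 3 * α ^ 6 * α ^ 5 = 1 by linear_combination (α ^ 7 + 1) * a7]
    simp
  have : ([1, α, α ^ 2, α ^ 4, α ^ 3, α ^ 6, α ^ 5].map lin).prod =
      lin 1 * (lin α * lin (α ^ 2) * lin (α ^ 4)) * (lin (α ^ 3) * lin (α ^ 6) * lin (α ^ 5)) := by
    simp [mul_assoc]
  rw [this, A, B]
  simp only [lin, map_one]
  linear_combination (X + X ^ 2 + 2 * X ^ 3 + 2 * X ^ 4 + X ^ 5 + X ^ 6) * h2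

lemma ind_W (k : ℕ) (R : K → K → K → K → Prop) {n : ℕ} (x : Fin n → K) :
    ind k R (W x) = open Classical in
      if R 1 (evalE 1 x) (evalE 3 x) (evalE k x) then 1 else 0 := by
  unfold ind
  rw [coeff_W, coeff_W, coeff_W, coeff_W, evalE_zero]

lemma ind_mul (k : ℕ) (R : K → K → K → K → Prop) {n : ℕ} (x : Fin n → K) (a : K) (m : ℕ) :
    ind k R (W x * (1 + C a * X ^ m)) = open Classical in
      if R (1 + a * if m ≤ 0 then evalE (0 - m) x else 0)
        (evalE 1 x + a * if m ≤ 1 then evalE (1 - m) x else 0)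
        (evalE 3 x + a * if m ≤ 3 then evalE (3 - m) x else 0)
        (evalE k x + a * if m ≤ k then evalE (k - m) x else 0) then 1 else 0 := by
  unfold ind
  rw [coeff_mul_one_add, coeff_mul_one_add, coeff_mul_one_add, coeff_mul_one_add]
  have h : ∀ i, (W x).coeff i = evalE i x := coeff_W x
  rw [funext h]
  beta_reduce
  rw [evalE_zero]

lemma E_add (n : ℕ) (f g h : K[X] → ℝ)
    (H : ∀ x : Fin n → K, f (W x) = g (W x) + h (W x)) : E n f = E n g + E n h := by
  simp only [E, SS, one_mul, ← add_div, ← Finset.sum_add_distrib, H]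

lemma E_congr (n : ℕ) (f g : K[X] → ℝ)
    (H : ∀ x : Fin n → K, f (W x) = g (W x)) : E n f = E n g := by
  simp only [E, SS, one_mul, H]

lemma E_one (hK : Fintype.card K = 8) (n : ℕ) : E n (fun _ : K[X] => 1) = 1 := by
  simp [E, SS, hK]

lemma T2 (hK : Fintype.card K = 8) (k : ℕ) (hk : k < 8) :
    Tendsto (fun n => E n (ind (K := K) k (fun c0 c1 _ _ => c0 = 1 ∧ c1 = 0)))
      atTop (𝓝 (1 / 8)) := by
  have h1 : Tendsto (fun n => E n (fun _ : K[X] => 1)) atTop (𝓝 1) := by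
    simp only [E_one hK]; exact tendsto_const_nhds
  have := avg hK (ind (K := K) k (fun c0 c1 _ _ => c0 = 1 ∧ c1 = 0)) _ (ind_good k hk _)
    (fun y : K => [y]) (fun n x => ?_) h1
  · rw [hK] at this; exact_mod_cast this
  · rw [← sum_ind hK 1 (by simp) (evalE 1 x) 1 0 one_ne_zero]
    refine Finset.sum_congr rfl fun y _ => ?_
    have e : ([y].map lin).prod = 1 + C y * X ^ 1 := by simp [lin]
    rw [e, ind_mul]
    simp [evalE_zero]

lemma T3 (hK : Fintype.card K = 8) (α : K) (hα : α ^ 3 + α + 1 = 0) (k : ℕ) (hk : k < 8) :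
    Tendsto (fun n => E n (ind (K := K) k (fun c0 c1 c3 _ => c0 = 1 ∧ c1 = 0 ∧ c3 = 0)))
      atTop (𝓝 (1 / 64)) := by
  have hne : α * (1 + α) ≠ 0 := by
    intro h
    have h0 : α ^ 2 = -α := by linear_combination h
    have h2z := two_zero hK
    have : (1 : K) = 0 := by linear_combination hα - (α - 1) * h - α * h2z
    exact one_ne_zero this
  have := avg hK (ind (K := K) k (fun c0 c1 c3 _ => c0 = 1 ∧ c1 = 0 ∧ c3 = 0)) _ (ind_good k hk _)
    (fun y : K => [y, α * y, y + α * y]) (fun n x => ?_) (T2 hK k hk)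
  · rw [hK] at this; convert this using 2; norm_num
  · have e : ∀ y : K, ([y, α * y, y + α * y].map lin).prod =
        1 + C (y ^ 2 + y * (α * y) + (α * y) ^ 2) * X ^ 2 +
          C (α * (1 + α) * y ^ 3) * X ^ 3 := by
      intro y
      rw [show α * (1 + α) * y ^ 3 = y * (α * y) * (y + α * y) by ring, ← lin_triple hK]
      simp [mul_assoc]
    have e0 : ∀ (p : K[X]) (a b : K), p * (1 + C a * X ^ 2 + C b * X ^ 3) =
        p * (1 + C a * X ^ 2) + C b * p * X ^ 3 := by intros; ring
    have hc : ∀ y : K, ind k (fun c0 c1 c3 _ => c0 = 1 ∧ c1 = 0 ∧ c3 = 0)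
        (W x * ([y, α * y, y + α * y].map lin).prod) =
        if evalE 1 x = 0 ∧ evalE 3 x + α * (1 + α) * y ^ 3 = 0 then 1 else 0 := by
      intro y
      rw [e, e0]
      generalize y ^ 2 + y * (α * y) + (α * y) ^ 2 = q
      generalize α * (1 + α) * y ^ 3 = r
      have c0 : (W x * (1 + C q * X ^ 2) + C r * W x * X ^ 3).coeff 0 = 1 := by
        rw [coeff_add, coeff_mul_one_add, coeff_mul_X_pow']
        simp only [coeff_W, evalE_zero]
        simp
      have c1 : (W x * (1 + C q * X ^ 2) + C r * W x * X ^ 3).coeff 1 = evalE 1 x := by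
        rw [coeff_add, coeff_mul_one_add, coeff_mul_X_pow']
        simp [coeff_W]
      have c3 : (W x * (1 + C q * X ^ 2) + C r * W x * X ^ 3).coeff 3 =
          evalE 3 x + q * evalE 1 x + r := by
        rw [coeff_add, coeff_mul_one_add, coeff_mul_X_pow', if_pos le_rfl, coeff_C_mul]
        simp only [coeff_W, Nat.sub_self, evalE_zero]
        simp
      unfold ind
      rw [c0, c1, c3]
      by_cases h : evalE 1 x = 0 <;> simp [h]
    rw [Finset.sum_congr rfl fun y _ => hc y, ind_W]
    by_cases h : evalE 1 x = 0
    · have := sum_ind hK 3 (by simp) (evalE 3 x) _ 0 hne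
      simp only [h, true_and, if_true, and_self]
      exact this
    · simp [h]

lemma T1n (hK : Fintype.card K = 8) (k : ℕ) (hk : k < 8) :
    Tendsto (fun n => E n (ind (K := K) k (fun _ c1 _ _ => c1 ≠ 0)))
      atTop (𝓝 (7 / 8)) := by
  have h1 : Tendsto (fun _ : ℕ => (1 : ℝ)) atTop (𝓝 1) := tendsto_const_nhds
  have := h1.sub (T2 (K := K) hK k hk)
  norm_num at this
  refine this.congr fun n => ?_
  rw [sub_eq_iff_eq_add, ← E_one hK n]
  refine E_add n _ _ _ fun x => ?_
  rw [ind_W, ind_W]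
  by_cases h : evalE 1 x = 0 <;> simp [h]

lemma T3n (hK : Fintype.card K = 8) (α : K) (hα : α ^ 3 + α + 1 = 0) (k : ℕ) (hk : k < 8) :
    Tendsto (fun n => E n (ind (K := K) k (fun _ c1 c3 _ => c1 = 0 ∧ c3 ≠ 0)))
      atTop (𝓝 (7 / 64)) := by
  have := (T2 (K := K) hK k hk).sub (T3 hK α hα k hk)
  norm_num at this
  refine this.congr fun n => ?_
  rw [sub_eq_iff_eq_add]
  refine E_add n _ _ _ fun x => ?_
  rw [ind_W, ind_W, ind_W]
  by_cases h : evalE 1 x = 0 <;> by_cases h' : evalE 3 x = 0 <;> simp [h, h']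

lemma T4 (hK : Fintype.card K = 8) (β : K) :
    Tendsto (fun n => E n (ind (K := K) 5 (fun _ c1 _ ck => c1 ≠ 0 ∧ ck = β)))
      atTop (𝓝 (7 / 64)) := by
  have := avg hK (ind (K := K) 5 (fun _ c1 _ ck => c1 ≠ 0 ∧ ck = β)) _ (ind_good 5 (by omega) _)
    (fun y : K => [y, y, y, y]) (fun n x => ?_) (T1n hK 5 (by omega))
  · rw [hK] at this; convert this using 2; norm_num
  · have e : ∀ y : K, ([y, y, y, y].map lin).prod = 1 + C (y ^ 4) * X ^ 4 := by
      intro y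
      rw [← lin_four hK]
      simp [pow_succ, mul_assoc]
    simp only [e, ind_mul, ind_W]
    by_cases h : evalE 1 x = 0
    · simp [h]
    · have := sum_ind hK 4 (by simp) (evalE 5 x) _ β h
      simp only [mul_comm (evalE 1 x)] at this
      simp [h]
      simpa using this

lemma T5 (hK : Fintype.card K = 8) (α : K) (hα : α ^ 3 + α + 1 = 0) (β : K) :
    Tendsto (fun n => E n (ind (K := K) 5 (fun _ c1 c3 ck => (c1 = 0 ∧ c3 ≠ 0) ∧ ck = β)))
      atTop (𝓝 (7 / 512)) := by
  have := avg hK (ind (K := K) 5 (fun _ c1 c3 ck => (c1 = 0 ∧ c3 ≠ 0) ∧ ck = β)) _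
    (ind_good 5 (by omega) _)
    (fun y : K => [y, y]) (fun n x => ?_) (T3n hK α hα 5 (by omega))
  · rw [hK] at this; convert this using 2; norm_num
  · have e : ∀ y : K, ([y, y].map lin).prod = 1 + C (y ^ 2) * X ^ 2 := by
      intro y
      rw [← lin_sq hK]
      simp [pow_succ]
    simp only [e, ind_mul, ind_W]
    by_cases h : evalE 1 x = 0 ∧ evalE 3 x ≠ 0
    · have := sum_ind hK 2 (by simp) (evalE 5 x) _ β h.2
      simp only [mul_comm (evalE 3 x)] at this
      simp [h.1, h.2]
      simpa using this
    · by_cases h' : evalE 1 x = 0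
      · have h3 : evalE 3 x = 0 := by simpa [h'] using h
        simp [h', h3]
      · simp [h']

lemma U4 (hK : Fintype.card K = 8) (α : K) (hα : α ^ 3 + α + 1 = 0) (β : K) :
    Tendsto (fun n => E n (ind (K := K) 7 (fun _ c1 _ ck => c1 ≠ 0 ∧ ck = β)))
      atTop (𝓝 (7 / 64)) := by
  have hne : α * (1 + α) ≠ 0 := by
    intro h
    have h0 : α ^ 2 = -α := by linear_combination h
    have h2z := two_zero hK
    have : (1 : K) = 0 := by linear_combination hα - (α - 1) * h - α * h2z
    exact one_ne_zero this
  have := avg hK (ind (K := K) 7 (fun _ c1 _ ck => c1 ≠ 0 ∧ ck = β)) _ (ind_good 7 (by omega) _)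
    (fun y : K =>
      let z := (y ^ 2 + y * (α * y) + (α * y) ^ 2) ^ 4
      [y, y, α * y, α * y, y + α * y, y + α * y, z, z, z, z]) (fun n x => ?_) (T1n hK 7 (by omega))
  · rw [hK] at this; convert this using 2; norm_num
  · have e : ∀ y : K, ∃ r : K[X],
        ((let z := (y ^ 2 + y * (α * y) + (α * y) ^ 2) ^ 4
          [y, y, α * y, α * y, y + α * y, y + α * y, z, z, z, z]).map lin).prod =
          1 + C ((α * (1 + α)) ^ 2 * y ^ 6) * X ^ 6 + X ^ 8 * r := by
      intro y
      refine ⟨C ((y ^ 2 + y * (α * y) + (α * y) ^ 2) ^ 4) +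
          C ((y ^ 2 + y * (α * y) + (α * y) ^ 2) ^ 2 * (y * (α * y) * (y + α * y)) ^ 2) * X ^ 2,
        Eq.trans ?_ ((lin_triple_sq hK y (α * y)).trans ?_)⟩
      · simp only [List.map_cons, List.map_nil, List.prod_cons, List.prod_nil]
        ring
      · rw [show (α * (1 + α)) ^ 2 * y ^ 6 = (y * (α * y) * (y + α * y)) ^ 2 by ring]
    have hc : ∀ y : K, ind 7 (fun _ c1 _ ck => c1 ≠ 0 ∧ ck = β) (W x *
        ((let z := (y ^ 2 + y * (α * y) + (α * y) ^ 2) ^ 4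
          [y, y, α * y, α * y, y + α * y, y + α * y, z, z, z, z]).map lin).prod) =
        if evalE 1 x ≠ 0 ∧ evalE 7 x + (α * (1 + α)) ^ 2 * evalE 1 x * y ^ 6 = β then 1 else 0 := by
      intro y
      obtain ⟨r, hr⟩ := e y
      have e0 : ∀ (p : K[X]) (a : K), p * (1 + C a * X ^ 6 + X ^ 8 * r) =
        p * (1 + C a * X ^ 6) + p * r * X ^ 8 := by intros; ring
      rw [hr, e0]
      have c1 : (W x * (1 + C ((α * (1 + α)) ^ 2 * y ^ 6) * X ^ 6) + W x * r * X ^ 8).coeff 1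
          = evalE 1 x := by
        rw [coeff_add, coeff_mul_one_add, coeff_mul_X_pow']
        simp [coeff_W]
      have c7 : (W x * (1 + C ((α * (1 + α)) ^ 2 * y ^ 6) * X ^ 6) + W x * r * X ^ 8).coeff 7
          = evalE 7 x + (α * (1 + α)) ^ 2 * evalE 1 x * y ^ 6 := by
        rw [coeff_add, coeff_mul_one_add, coeff_mul_X_pow']
        simp [coeff_W]
        ring
      unfold ind
      rw [c1, c7]
      congr
    rw [Finset.sum_congr rfl fun y _ => hc y, ind_W]
    by_cases h : evalE 1 x = 0
    · simp [h]
    · have := sum_ind hK 6 (by simp) (evalE 7 x) _ β (mul_ne_zero (pow_ne_zero 2 hne) h)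
      simp only [ne_eq, h, not_false_eq_true, true_and, if_true]
      exact this

lemma U5 (hK : Fintype.card K = 8) (α : K) (hα : α ^ 3 + α + 1 = 0) (β : K) :
    Tendsto (fun n => E n (ind (K := K) 7 (fun _ c1 c3 ck => (c1 = 0 ∧ c3 ≠ 0) ∧ ck = β)))
      atTop (𝓝 (7 / 512)) := by
  have := avg hK (ind (K := K) 7 (fun _ c1 c3 ck => (c1 = 0 ∧ c3 ≠ 0) ∧ ck = β)) _
    (ind_good 7 (by omega) _)
    (fun y : K => [y, y, y, y]) (fun n x => ?_) (T3n hK α hα 7 (by omega))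
  · rw [hK] at this; convert this using 2; norm_num
  · have e : ∀ y : K, ([y, y, y, y].map lin).prod = 1 + C (y ^ 4) * X ^ 4 := by
      intro y
      rw [← lin_four hK]
      simp [pow_succ, mul_assoc]
    simp only [e, ind_mul, ind_W]
    by_cases h : evalE 1 x = 0 ∧ evalE 3 x ≠ 0
    · have := sum_ind hK 4 (by simp) (evalE 7 x) _ β h.2
      simp only [mul_comm (evalE 3 x)] at this
      simp [h.1, h.2]
      simpa using this
    · by_cases h' : evalE 1 x = 0
      · have h3 : evalE 3 x = 0 := by simpa [h'] using h
        simp [h', h3]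
      · simp [h']

lemma U6 (hK : Fintype.card K = 8) (α : K) (hα : α ^ 3 + α + 1 = 0) (β : K) (hβ : β = 0 ∨ β = 1) :
    Tendsto (fun n => E n (ind (K := K) 7 (fun c0 c1 c3 ck => (c0 = 1 ∧ c1 = 0 ∧ c3 = 0) ∧ ck = β)))
      atTop (𝓝 (1 / 128)) := by
  have := avg hK (ind (K := K) 7 (fun c0 c1 c3 ck => (c0 = 1 ∧ c1 = 0 ∧ c3 = 0) ∧ ck = β)) _
    (ind_good 7 (by omega) _)
    (fun b : Bool => if b then [1, α, α ^ 2, α ^ 4, α ^ 3, α ^ 6, α ^ 5] else [])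
    (fun n x => ?_) (T3 hK α hα 7 (by omega))
  · rw [Fintype.card_bool] at this; convert this using 2; norm_num
  · have h11 : (1 : K) + 1 = 0 := by rw [one_add_one_eq_two]; exact two_zero hK
    simp only [Fintype.sum_bool, if_true, Bool.false_eq_true, if_false, lin_all hK α hα,
      List.map_nil, List.prod_nil, mul_one, ind_mul, ind_W]
    by_cases h : evalE 1 x = 0 ∧ evalE 3 x = 0
    · rcases (newton hK x h.1 h.2).2 with h7 | h7 <;> rcases hβ with rfl | rfl <;>
        simp [evalE_zero, h.1, h.2, h7, h11]
    · simp [evalE_zero, h]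

lemma E_split (k n : ℕ) (β : K) :
    ((Finset.univ.filter (fun x : Fin n → K => evalE k x = β)).card : ℝ) / (8 : ℝ) ^ n =
      E n (ind (K := K) k (fun _ c1 _ ck => c1 ≠ 0 ∧ ck = β)) +
      E n (ind (K := K) k (fun _ c1 c3 ck => (c1 = 0 ∧ c3 ≠ 0) ∧ ck = β)) +
      E n (ind (K := K) k (fun c0 c1 c3 ck => (c0 = 1 ∧ c1 = 0 ∧ c3 = 0) ∧ ck = β)) := by
  simp only [E, SS, one_mul, ← add_div, ← Finset.sum_add_distrib, ind_W]
  congr 1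
  rw [Finset.card_filter]
  push_cast
  refine Finset.sum_congr rfl fun x _ => ?_
  by_cases h : evalE 1 x = 0 <;> by_cases h' : evalE 3 x = 0 <;> by_cases h'' : evalE k x = β <;>
    simp [h, h', h'']

lemma final (k : ℕ) (β : K) (a b c d : ℝ)
    (h1 : Tendsto (fun n => E n (ind (K := K) k (fun _ c1 _ ck => c1 ≠ 0 ∧ ck = β))) atTop (𝓝 a))
    (h2 : Tendsto (fun n => E n (ind (K := K) k (fun _ c1 c3 ck => (c1 = 0 ∧ c3 ≠ 0) ∧ ck = β)))
      atTop (𝓝 b))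
    (h3 : Tendsto (fun n => E n (ind (K := K) k
      (fun c0 c1 c3 ck => (c0 = 1 ∧ c1 = 0 ∧ c3 = 0) ∧ ck = β))) atTop (𝓝 c))
    (hd : a + b + c = d) :
    Tendsto (fun n : ℕ =>
        ((Finset.univ.filter (fun x : Fin n → K => evalE k x = β)).card : ℝ) / (8 : ℝ) ^ n)
      atTop (𝓝 d) := by
  rw [← hd]
  simp only [E_split]
  exact (h1.add h2).add h3

lemma T6_zero (k : ℕ) (β : K)
    (h : ∀ (n : ℕ) (x : Fin n → K), evalE 1 x = 0 → evalE 3 x = 0 → evalE k x ≠ β) :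
    Tendsto (fun n => E n (ind (K := K) k
      (fun c0 c1 c3 ck => (c0 = 1 ∧ c1 = 0 ∧ c3 = 0) ∧ ck = β))) atTop (𝓝 0) := by
  refine tendsto_const_nhds.congr fun n => ?_
  simp only [E, SS, one_mul, ind_W]
  rw [Finset.sum_eq_zero, zero_div]
  intro x _
  refine if_neg fun hx => h n x hx.1.2.1 hx.1.2.2 hx.2

lemma T6 (hK : Fintype.card K = 8) (α : K) (hα : α ^ 3 + α + 1 = 0) :
    Tendsto (fun n => E n (ind (K := K) 5
      (fun c0 c1 c3 ck => (c0 = 1 ∧ c1 = 0 ∧ c3 = 0) ∧ ck = 0))) atTop (𝓝 (1 / 64)) := by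
  refine (T3 hK α hα 5 (by omega)).congr fun n => E_congr n _ _ fun x => ?_
  rw [ind_W, ind_W]
  by_cases h : evalE 1 x = 0 ∧ evalE 3 x = 0
  · simp [h.1, h.2, (newton hK x h.1 h.2).1]
  · simp [h]

end F8

end

/-- **concluding remarks.** Over `𝔽_8 = 𝔽_2(α)` with `α³ + α + 1 = 0`:
(i) the limiting value distribution of `e_5` is `71/512` at `0` and `63/512` at every
nonzero `β`; (ii) the limiting value distribution of `e_7` is `67/512` at `0` and `1`, and
`63/512` at every `β ∉ {0, 1}`. -/
theorem limit_distribution_F8_e5_e7 (K : Type*) [Field K] [Fintype K] [DecidableEq K]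
    (hK : Fintype.card K = 8) (α : K) (hα : α ^ 3 + α + 1 = 0) :
    (Tendsto (fun n : ℕ =>
        ((Finset.univ.filter (fun x : Fin n → K => evalE 5 x = 0)).card : ℝ) / (8 : ℝ) ^ n)
      atTop (𝓝 (71 / 512)) ∧
     ∀ β : K, β ≠ 0 →
      Tendsto (fun n : ℕ =>
          ((Finset.univ.filter (fun x : Fin n → K => evalE 5 x = β)).card : ℝ) / (8 : ℝ) ^ n)
        atTop (𝓝 (63 / 512))) ∧
    ((∀ β : K, (β = 0 ∨ β = 1) →
      Tendsto (fun n : ℕ =>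
          ((Finset.univ.filter (fun x : Fin n → K => evalE 7 x = β)).card : ℝ) / (8 : ℝ) ^ n)
        atTop (𝓝 (67 / 512))) ∧
     ∀ β : K, β ≠ 0 → β ≠ 1 →
      Tendsto (fun n : ℕ =>
          ((Finset.univ.filter (fun x : Fin n → K => evalE 7 x = β)).card : ℝ) / (8 : ℝ) ^ n)
        atTop (𝓝 (63 / 512))) := by
  refine ⟨⟨?_, fun β hβ => ?_⟩, fun β hβ => ?_, fun β h0 h1 => ?_⟩
  · exact F8.final 5 0 _ _ _ _ (F8.T4 hK 0) (F8.T5 hK α hα 0) (F8.T6 hK α hα) (by norm_num)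
  · exact F8.final 5 β _ _ _ _ (F8.T4 hK β) (F8.T5 hK α hα β)
      (F8.T6_zero 5 β fun n x e1 e3 h => hβ (h.symm.trans (F8.newton hK x e1 e3).1)) (by norm_num)
  · exact F8.final 7 β _ _ _ _ (F8.U4 hK α hα β) (F8.U5 hK α hα β) (F8.U6 hK α hα β hβ)
      (by norm_num)
  · exact F8.final 7 β _ _ _ _ (F8.U4 hK α hα β) (F8.U5 hK α hα β)
      (F8.T6_zero 7 β fun n x e1 e3 h => by
        rcases (F8.newton hK x e1 e3).2 with h' | h'
        · exact h0 (h.symm.trans h')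
        · exact h1 (h.symm.trans h')) (by norm_num)
end
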